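/- arXiv:1601.05272 — 8 statements merged into one kernel-verified Lean document; each statement's English description precedes it below -/
import Mathlib

section
/- Let A : ℝ³ → ℝ³ have components in L²_loc, V : ℝ³ → ℝ in L¹_loc, U ≥ 0, m ∈ ℕ, and suppose there are f ∈ C^∞(ℝ³;ℝ) and w ∈ ℝ³∖{0} with f(x+w) = f(x), A(x+w) = A(x) + ∇f(x), and V(x+w) = V(x) for all x ∈ ℝ³. For an m-electron wave function φ and k ∈ ℕ define the magnetically translated function φ^{(k)}(x₁,…,x_m) := φ(x₁+kw,…,x_m+kw) · e^{i k ∑_{j=1}^m f(x_j)}. Then φ^{(k)} is again an m-electron wave function with ‖φ^{(k)}‖ = ‖φ‖, and P^{(m,1)}(A,V,U,φ^{(k)}) = P^{(m,1)}(A,V,U,φ). -/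
open MeasureTheory Metric Finset

noncomputable section

abbrev E3 := EuclideanSpace ℝ (Fin 3)

/-- Squared Euclidean norm of a spinor value in `ℂ^(2^N)`. -/
def nsq {N : ℕ} (v : (Fin N → Fin 2) → ℂ) : ℝ := ∑ s : Fin N → Fin 2, ‖v s‖ ^ 2

/-- An `N`-electron wave function: smooth, compactly supported, antisymmetric under
simultaneous permutation of positions and spins. -/
def IsWaveFunction (N : ℕ) (ψ : (Fin N → E3) → (Fin N → Fin 2) → ℂ) : Prop :=
  ContDiff ℝ (⊤ : ℕ∞) ψ ∧ HasCompactSupport ψ ∧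
    ∀ (σ : Equiv.Perm (Fin N)) (X : Fin N → E3) (s : Fin N → Fin 2),
      ψ (X ∘ σ) (s ∘ σ) = ((Equiv.Perm.sign σ : ℤ) : ℂ) * ψ X s

/-- The one-particle electron density. -/
def rho (N : ℕ) (ψ : (Fin N → E3) → (Fin N → Fin 2) → ℂ) (x : E3) : ℝ :=
  ∑ j : Fin N, ∫ Y : { i : Fin N // i ≠ j } → E3,
    nsq (ψ (fun i => if h : i = j then x else Y ⟨i, h⟩))

/-- Directional partial derivative `∂ψ/∂(x_j)_k`. -/
def pd {N : ℕ} (ψ : (Fin N → E3) → ℂ) (j : Fin N) (k : Fin 3) (X : Fin N → E3) : ℂ :=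
  fderiv ℝ ψ X (Pi.single j (EuclideanSpace.single k 1))

/-- Pointwise squared norm of the magnetic gradient `(-i∇_{x_j} + A(x_j))ψ`. -/
def magSq (N : ℕ) (A : E3 → E3) (ψ : (Fin N → E3) → (Fin N → Fin 2) → ℂ)
    (j : Fin N) (X : Fin N → E3) : ℝ :=
  ∑ k : Fin 3, ∑ s : Fin N → Fin 2,
    ‖(-Complex.I) * pd (fun X' => ψ X' s) j k X + (A (X j) k : ℂ) * ψ X s‖ ^ 2

/-- Coulomb repulsion `∑_{i<j} 1/|x_i - x_j|`. -/
def coul (N : ℕ) (X : Fin N → E3) : ℝ :=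
  ∑ p ∈ Finset.univ.filter (fun p : Fin N × Fin N => p.1 < p.2), 1 / dist (X p.1) (X p.2)

/-- The Pekar-Tomasevich functional. -/
def pekar (N : ℕ) (α : ℝ) (A : E3 → E3) (V : E3 → ℝ) (U : ℝ)
    (ψ : (Fin N → E3) → (Fin N → Fin 2) → ℂ) : ℝ :=
  (∑ j : Fin N, ∫ X : Fin N → E3, magSq N A ψ j X)
    + (∫ X : Fin N → E3, (∑ j : Fin N, V (X j)) * nsq (ψ X))
    + U * (∫ X : Fin N → E3, coul N X * nsq (ψ X))
    - α * (∫ x : E3, ∫ y : E3, rho N ψ x * rho N ψ y / dist x y)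

/-- The Pekar-Tomasevich ground state energy `C^(N,α)(A,V,U)`. -/
def pekarInf (N : ℕ) (α : ℝ) (A : E3 → E3) (V : E3 → ℝ) (U : ℝ) : ℝ :=
  sInf { E | ∃ ψ, IsWaveFunction N ψ ∧ (∫ X : Fin N → E3, nsq (ψ X)) = 1 ∧
    pekar N α A V U ψ = E }

/-- The components of `A` are in `L²_loc`. -/
def AL2loc (A : E3 → E3) : Prop :=
  ∀ k : Fin 3, LocallyIntegrable (fun x : E3 => (A x k) ^ 2) volume

/-- `V` is infinitesimally `-Δ`-form-bounded. -/
def InfFormBounded (V : E3 → ℝ) : Prop :=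
  ∀ ε > (0 : ℝ), ∃ C : ℝ, ∀ φ : E3 → Fin 2 → ℂ, ContDiff ℝ (⊤ : ℕ∞) φ →
    HasCompactSupport φ →
    |∫ x : E3, V x * ∑ s : Fin 2, ‖φ x s‖ ^ 2| ≤
      ε * (∫ x : E3, ∑ k : Fin 3, ∑ s : Fin 2,
        ‖fderiv ℝ (fun y => φ y s) x (EuclideanSpace.single k 1)‖ ^ 2)
      + C * (∫ x : E3, ∑ s : Fin 2, ‖φ x s‖ ^ 2)

end

noncomputable section

/-- The magnetic translation of `φ` by `k • w` with gauge phase `exp (i k ∑ f (x_j))`. -/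
def magTrans {m : ℕ} (f : E3 → ℝ) (w : E3) (k : ℕ) (φ : (Fin m → E3) → (Fin m → Fin 2) → ℂ) :
    (Fin m → E3) → (Fin m → Fin 2) → ℂ :=
  fun X s => φ (fun i => X i + (k : ℝ) • w) s *
    Complex.exp (Complex.I * (k : ℂ) * ∑ j : Fin m, (f (X j) : ℂ))

theorem norm_exp_phase {m : ℕ} (f : E3 → ℝ) (k : ℕ) (X : Fin m → E3) :
    ‖Complex.exp (Complex.I * (k : ℂ) * ∑ j : Fin m, (f (X j) : ℂ))‖ = 1 := by
  have h : Complex.I * (k : ℂ) * ∑ j : Fin m, (f (X j) : ℂ) =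
      ((k * ∑ j : Fin m, f (X j) : ℝ) : ℂ) * Complex.I := by
    push_cast
    ring
  rw [h, Complex.norm_exp_ofReal_mul_I]

theorem nsq_magTrans {m : ℕ} (f : E3 → ℝ) (w : E3) (k : ℕ)
    (φ : (Fin m → E3) → (Fin m → Fin 2) → ℂ) (X : Fin m → E3) :
    nsq (magTrans f w k φ X) = nsq (φ (fun i => X i + (k : ℝ) • w)) := by
  simp only [nsq, magTrans, norm_mul, norm_exp_phase, mul_one]

/-- Diagonal translation preserves integrals over configuration space. -/
theorem integral_comp_translate {ι : Type*} [Fintype ι] (v : E3) (F : (ι → E3) → ℝ) :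
    ∫ X : ι → E3, F (fun i => X i + v) = ∫ X : ι → E3, F X :=
  integral_add_right_eq_self F (fun _ => v)

theorem contDiff_phase {m : ℕ} {f : E3 → ℝ} (hf : ContDiff ℝ (⊤ : ℕ∞) f) (k : ℕ) :
    ContDiff ℝ (⊤ : ℕ∞) (fun X : Fin m → E3 =>
      Complex.exp (Complex.I * (k : ℂ) * ∑ j : Fin m, (f (X j) : ℂ))) := by
  refine ContDiff.cexp (contDiff_const.mul (ContDiff.sum fun j _ => ?_))
  exact Complex.ofRealCLM.contDiff.comp (hf.comp (contDiff_apply ℝ E3 j))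

theorem contDiff_translate {m : ℕ} (v : E3) :
    ContDiff ℝ (⊤ : ℕ∞) (fun (X : Fin m → E3) (i : Fin m) => X i + v) :=
  contDiff_id.add (contDiff_const (c := fun _ : Fin m => v))

theorem IsWaveFunction.magTrans {m : ℕ} {f : E3 → ℝ} (hf : ContDiff ℝ (⊤ : ℕ∞) f) (w : E3)
    (k : ℕ) {φ : (Fin m → E3) → (Fin m → Fin 2) → ℂ} (hφ : IsWaveFunction m φ) :
    IsWaveFunction m (magTrans f w k φ) := by
  obtain ⟨hsmooth, hsupp, hanti⟩ := hφ
  refine ⟨?_, ?_, ?_⟩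
  · rw [contDiff_pi]
    intro s
    exact ((contDiff_pi.1 hsmooth s).comp (contDiff_translate _)).mul (contDiff_phase hf k)
  · have h1 : HasCompactSupport (fun X : Fin m → E3 => φ (fun i => X i + (k : ℝ) • w)) :=
      hsupp.comp_homeomorph (Homeomorph.addRight (fun _ : Fin m => (k : ℝ) • w))
    refine h1.mono fun X hX h0 => hX ?_
    funext s
    simp only [_root_.magTrans]
    rw [show φ (fun i => X i + (k : ℝ) • w) = 0 from h0]
    simp
  · intro σ X s
    have h1 := hanti σ (fun i => X i + (k : ℝ) • w) s
    have h2 : ∑ j : Fin m, (f ((X ∘ σ) j) : ℂ) = ∑ j : Fin m, (f (X j) : ℂ) :=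
      Equiv.sum_comp σ fun j => (f (X j) : ℂ)
    simp only [_root_.magTrans]
    rw [h2, ← mul_assoc, ← h1]
    rfl

theorem rho_magTrans {m : ℕ} (f : E3 → ℝ) (w : E3) (k : ℕ)
    (φ : (Fin m → E3) → (Fin m → Fin 2) → ℂ) (x : E3) :
    rho m (magTrans f w k φ) x = rho m φ (x + (k : ℝ) • w) := by
  unfold rho
  refine Finset.sum_congr rfl fun j _ => ?_
  symm
  rw [← integral_comp_translate ((k : ℝ) • w)]
  refine integral_congr_ae (Filter.Eventually.of_forall fun Y => ?_)
  simp only [nsq_magTrans]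
  congr 2
  funext i
  split_ifs <;> rfl

theorem apply_add_nsmul_of_gradient {A : E3 → E3} {f : E3 → ℝ} {w : E3}
    (hfper : ∀ x : E3, f (x + w) = f x)
    (hAper : ∀ x : E3, A (x + w) = A x + gradient f x) (k : ℕ) (x : E3) :
    A (x + (k : ℝ) • w) = A x + (k : ℝ) • gradient f x := by
  have hgrad : ∀ y : E3, gradient f (y + w) = gradient f y := by
    intro y
    unfold gradient
    rw [← fderiv_comp_add_right w, funext hfper]
  induction k generalizing x with
  | zero => simp
  | succ n ih =>
    have h : x + ((n + 1 : ℕ) : ℝ) • w = (x + w) + (n : ℝ) • w := by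
      push_cast
      module
    rw [h, ih, hAper, hgrad]
    push_cast
    module

theorem gradient_apply_eq_fderiv (f : E3 → ℝ) (x : E3) (l : Fin 3) :
    gradient f x l = fderiv ℝ f x (EuclideanSpace.single l 1) := by
  have h : inner ℝ (gradient f x) (EuclideanSpace.single l (1 : ℝ)) =
      fderiv ℝ f x (EuclideanSpace.single l 1) := by
    unfold gradient
    exact InnerProductSpace.toDual_symm_apply
  rw [← h, EuclideanSpace.inner_single_right]
  simp

theorem pd_magTrans {m : ℕ} {f : E3 → ℝ} (hf : ContDiff ℝ (⊤ : ℕ∞) f) (w : E3) (k : ℕ)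
    {φ : (Fin m → E3) → (Fin m → Fin 2) → ℂ} (hφ : ContDiff ℝ (⊤ : ℕ∞) φ)
    (s : Fin m → Fin 2) (j : Fin m) (l : Fin 3) (X : Fin m → E3) :
    pd (fun X' => magTrans f w k φ X' s) j l X =
      (pd (fun X' => φ X' s) j l (fun i => X i + (k : ℝ) • w) +
        Complex.I * k * (gradient f (X j) l : ℂ) * φ (fun i => X i + (k : ℝ) • w) s) *
      Complex.exp (Complex.I * (k : ℂ) * ∑ j : Fin m, (f (X j) : ℂ)) := by
  set v : Fin m → E3 := fun _ => (k : ℝ) • w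
  have hφs : Differentiable ℝ (fun X' => φ X' s) :=
    (contDiff_pi.1 hφ s).differentiable (by simp)
  have h1 : HasFDerivAt (fun X' : Fin m → E3 => φ (X' + v) s)
      (fderiv ℝ (fun X' => φ X' s) (X + v)) X :=
    by
    have h := (hφs (X + v)).hasFDerivAt.comp X ((hasFDerivAt_id X).add_const v)
    rwa [ContinuousLinearMap.comp_id] at h
  have h2 : ∀ i : Fin m, HasFDerivAt (fun X' : Fin m → E3 => (f (X' i) : ℂ))
      (Complex.ofRealCLM ∘L (fderiv ℝ f (X i) ∘L
        (ContinuousLinearMap.proj i : (Fin m → E3) →L[ℝ] E3))) X := fun i =>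
    Complex.ofRealCLM.hasFDerivAt.comp X
      (((hf.differentiable (by simp)) (X i)).hasFDerivAt.comp X
        (ContinuousLinearMap.proj i : (Fin m → E3) →L[ℝ] E3).hasFDerivAt)
  have h3 := ((HasFDerivAt.fun_sum (u := Finset.univ) fun i _ => h2 i).const_mul
    (Complex.I * (k : ℂ))).cexp
  have h4 := h1.mul h3
  have h5 : fderiv ℝ (fun X' => magTrans f w k φ X' s) X = _ := h4.fderiv
  unfold pd
  rw [h5, gradient_apply_eq_fderiv]
  have hsum : ∑ i : Fin m, ((fderiv ℝ f (X i)
      ((Pi.single j (EuclideanSpace.single l (1 : ℝ)) : Fin m → E3) i) : ℝ) : ℂ) =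
      (fderiv ℝ f (X j) (EuclideanSpace.single l 1) : ℂ) := by
    rw [Finset.sum_eq_single j]
    · simp
    · intro i _ hi
      simp [Pi.single_eq_of_ne hi]
    · simp
  simp only [_root_.add_apply, _root_.smul_apply,
    _root_.sum_apply, ContinuousLinearMap.comp_apply, ContinuousLinearMap.proj_apply,
    Complex.ofRealCLM_apply, smul_eq_mul, hsum]
  rw [show X + v = fun i => X i + (k : ℝ) • w from rfl]
  ring

theorem magSq_magTrans {m : ℕ} {A : E3 → E3} {f : E3 → ℝ} (hf : ContDiff ℝ (⊤ : ℕ∞) f) {w : E3}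
    (hfper : ∀ x : E3, f (x + w) = f x)
    (hAper : ∀ x : E3, A (x + w) = A x + gradient f x) (k : ℕ)
    {φ : (Fin m → E3) → (Fin m → Fin 2) → ℂ} (hφ : ContDiff ℝ (⊤ : ℕ∞) φ)
    (j : Fin m) (X : Fin m → E3) :
    magSq m A (magTrans f w k φ) j X = magSq m A φ j (fun i => X i + (k : ℝ) • w) := by
  unfold magSq
  refine Finset.sum_congr rfl fun l _ => Finset.sum_congr rfl fun s _ => ?_
  have h : (-Complex.I) * pd (fun X' => magTrans f w k φ X' s) j l X +
      (A (X j) l : ℂ) * magTrans f w k φ X s =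
      ((-Complex.I) * pd (fun X' => φ X' s) j l (fun i => X i + (k : ℝ) • w) +
        (A (X j + (k : ℝ) • w) l : ℂ) * φ (fun i => X i + (k : ℝ) • w) s) *
      Complex.exp (Complex.I * (k : ℂ) * ∑ j : Fin m, (f (X j) : ℂ)) := by
    rw [pd_magTrans hf w k hφ, apply_add_nsmul_of_gradient hfper hAper]
    simp only [magTrans, PiLp.add_apply, PiLp.smul_apply, smul_eq_mul]
    push_cast
    linear_combination (-(k : ℂ) * (gradient f (X j) l : ℂ) *
      φ (fun i => X i + (k : ℝ) • w) s *
      Complex.exp (Complex.I * (k : ℂ) * ∑ j : Fin m, (f (X j) : ℂ))) * Complex.I_mul_I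
  rw [h, norm_mul, norm_exp_phase, mul_one]

theorem coul_translate {m : ℕ} (v : E3) (X : Fin m → E3) :
    coul m (fun i => X i + v) = coul m X := by
  simp only [coul, dist_add_right]

theorem pekar_magTrans {m : ℕ} (α : ℝ) {A : E3 → E3} {V : E3 → ℝ} (U : ℝ) {f : E3 → ℝ}
    (hf : ContDiff ℝ (⊤ : ℕ∞) f) {w : E3} (hfper : ∀ x : E3, f (x + w) = f x)
    (hAper : ∀ x : E3, A (x + w) = A x + gradient f x) (hVper : ∀ x : E3, V (x + w) = V x)
    (k : ℕ) {φ : (Fin m → E3) → (Fin m → Fin 2) → ℂ} (hφ : ContDiff ℝ (⊤ : ℕ∞) φ) :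
    pekar m α A V U (magTrans f w k φ) = pekar m α A V U φ := by
  have hV (x : E3) : V (x + (k : ℝ) • w) = V x := by
    rw [Nat.cast_smul_eq_nsmul]
    exact (show Function.Periodic V w from hVper).nsmul k x
  unfold pekar
  congr 1
  · congr 1
    · congr 1
      · refine Finset.sum_congr rfl fun j _ => ?_
        simp only [magSq_magTrans hf hfper hAper k hφ]
        exact integral_comp_translate _ (magSq m A φ j)
      · symm
        rw [← integral_comp_translate ((k : ℝ) • w)]
        simp only [nsq_magTrans, hV]
    · rw [← integral_comp_translate ((k : ℝ) • w) (fun X => coul m X * nsq (φ X))]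
      simp only [nsq_magTrans, coul_translate]
  · congr 1
    symm
    rw [← integral_add_right_eq_self _ ((k : ℝ) • w)]
    refine integral_congr_ae (Filter.Eventually.of_forall fun x => ?_)
    simp only
    rw [← integral_add_right_eq_self _ ((k : ℝ) • w)]
    simp only [rho_magTrans, dist_add_right]

/-- magnetic translations leave the Pekar-Tomasevich functional invariant.
For periodic fields (up to the gauge `∇f`), the magnetically translated function
`φ^(k)(x₁,…,x_m) = φ(x₁+kw,…,x_m+kw)·e^(ik∑f(x_j))` is again an `m`-electron wave
function with the same norm and the same Pekar-Tomasevich energy. -/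
theorem pekar_magnetic_translation
    (A : E3 → E3) (V : E3 → ℝ) (U : ℝ) (m : ℕ)
    (hA : AL2loc A) (hV : LocallyIntegrable V volume) (hU : 0 ≤ U)
    (f : E3 → ℝ) (w : E3) (hf : ContDiff ℝ (⊤ : ℕ∞) f) (hw : w ≠ 0)
    (hfper : ∀ x : E3, f (x + w) = f x)
    (hAper : ∀ x : E3, A (x + w) = A x + gradient f x)
    (hVper : ∀ x : E3, V (x + w) = V x)
    (φ : (Fin m → E3) → (Fin m → Fin 2) → ℂ) (hφ : IsWaveFunction m φ) (k : ℕ) :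
    IsWaveFunction m
        (fun X s => φ (fun i => X i + (k : ℝ) • w) s *
          Complex.exp (Complex.I * (k : ℂ) * ∑ j : Fin m, (f (X j) : ℂ))) ∧
    (∫ X : Fin m → E3,
        nsq ((fun X' s => φ (fun i => X' i + (k : ℝ) • w) s *
          Complex.exp (Complex.I * (k : ℂ) * ∑ j : Fin m, (f (X' j) : ℂ))) X)) =
      (∫ X : Fin m → E3, nsq (φ X)) ∧
    pekar m 1 A V U
        (fun X s => φ (fun i => X i + (k : ℝ) • w) s *
          Complex.exp (Complex.I * (k : ℂ) * ∑ j : Fin m, (f (X j) : ℂ))) =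
      pekar m 1 A V U φ := by
  refine ⟨hφ.magTrans hf w k, ?_, pekar_magTrans 1 U hf hfper hAper hVper k hφ.1⟩
  rw [← integral_comp_translate ((k : ℝ) • w) fun X => nsq (φ X)]
  exact integral_congr_ae (Filter.Eventually.of_forall fun X => nsq_magTrans f w k φ X)

end
end

section
/- Let φ be a normalized m-electron wave function and ψ a normalized n-electron wave function whose one-particle densities ρ_φ and ρ_ψ have disjoint supports in ℝ³. Define the antisymmetrized product (φ∧ψ)(z₁,…,z_{m+n}) := (1/(m+n)!) ∑_{σ ∈ S_{m+n}} sgn(σ) φ(z_{σ(1)},…,z_{σ(m)}) ψ(z_{σ(m+1)},…,z_{σ(m+n)}), where each z_j = (x_j, s_j) denotes a position–spin pair. Then ‖φ∧ψ‖²_{L²} = m! n! / (m+n)! (in particular φ∧ψ ≠ 0), and the density of the normalized function Φ := (φ∧ψ)/‖φ∧ψ‖ satisfies ρ_Φ = ρ_φ + ρ_ψ. -/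
open MeasureTheory Metric Finset

noncomputable section

/-- The antisymmetrized product `φ∧ψ` of an `m`- and an `n`-electron wave function:
`(φ∧ψ)(z₁,…,z_{m+n}) = (1/(m+n)!) ∑_{σ} sgn(σ) φ(z_{σ(1)},…,z_{σ(m)}) ψ(z_{σ(m+1)},…,z_{σ(m+n)})`,
where `z_j = (x_j, s_j)` is a position-spin pair. -/
def wedge (m n : ℕ) (φ : (Fin m → E3) → (Fin m → Fin 2) → ℂ)
    (ψ : (Fin n → E3) → (Fin n → Fin 2) → ℂ) :
    (Fin (m + n) → E3) → (Fin (m + n) → Fin 2) → ℂ :=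
  fun X s => (((m + n).factorial : ℂ))⁻¹ *
    ∑ σ : Equiv.Perm (Fin (m + n)),
      ((Equiv.Perm.sign σ : ℤ) : ℂ) *
        (φ (fun i => X (σ (Fin.castAdd n i))) (fun i => s (σ (Fin.castAdd n i))) *
          ψ (fun i => X (σ (Fin.natAdd m i))) (fun i => s (σ (Fin.natAdd m i))))

lemma nsq_nonneg {N : ℕ} (v : (Fin N → Fin 2) → ℂ) : 0 ≤ nsq v :=
  Finset.sum_nonneg fun _ _ => by positivity

lemma nsq_ne_zero {N : ℕ} {v : (Fin N → Fin 2) → ℂ} {s : Fin N → Fin 2} (h : v s ≠ 0) :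
    nsq v ≠ 0 := by
  have h1 : ‖v s‖ ^ 2 ≤ nsq v :=
    Finset.single_le_sum (f := fun s => ‖v s‖ ^ 2) (fun _ _ => by positivity) (Finset.mem_univ s)
  have h2 : 0 < ‖v s‖ ^ 2 := by positivity
  exact (h2.trans_le h1).ne'

lemma nsq_zero {N : ℕ} : nsq (0 : (Fin N → Fin 2) → ℂ) = 0 := by simp [nsq]

lemma nsq_smul {N : ℕ} (c : ℂ) (v : (Fin N → Fin 2) → ℂ) :
    nsq (fun s => c * v s) = ‖c‖ ^ 2 * nsq v := by
  simp only [nsq, Finset.mul_sum, norm_mul, mul_pow]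

lemma continuous_nsq {N : ℕ} : Continuous (nsq : ((Fin N → Fin 2) → ℂ) → ℝ) := by
  unfold nsq; fun_prop

/-- Insert the position `x` at the index `j`. -/
def insertAt {ι : Type*} [DecidableEq ι] (j : ι) (x : E3) (Y : { i : ι // i ≠ j } → E3) :
    ι → E3 :=
  fun i => if h : i = j then x else Y ⟨i, h⟩

lemma insertAt_self {ι : Type*} [DecidableEq ι] (j : ι) (x : E3) (Y : { i : ι // i ≠ j } → E3) :
    insertAt j x Y j = x := by simp [insertAt]

lemma insertAt_of_ne {ι : Type*} [DecidableEq ι] {i j : ι} (h : i ≠ j) (x : E3)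
    (Y : { i : ι // i ≠ j } → E3) : insertAt j x Y i = Y ⟨i, h⟩ := by simp [insertAt, h]

lemma insertAt_restrict {ι : Type*} [DecidableEq ι] (j : ι) (X : ι → E3) :
    insertAt j (X j) (fun i => X i) = X := by
  funext i
  by_cases h : i = j
  · subst h; exact insertAt_self _ _ _
  · exact insertAt_of_ne h _ _

lemma continuous_insertAt {ι : Type*} [DecidableEq ι] (j : ι) (x : E3) :
    Continuous (insertAt j x) := by
  refine continuous_pi fun i => ?_
  by_cases h : i = j
  · simp only [insertAt, h, dif_pos]; exact continuous_const
  · simp only [insertAt, h, dif_neg, not_false_eq_true]; exact continuous_apply _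

/-- A continuous function on configuration space vanishing unless all positions lie in some
fixed ball. -/
def ContBddSupp {ι : Type*} (g : (ι → E3) → ℝ) : Prop :=
  Continuous g ∧ ∃ R : ℝ, ∀ X, g X ≠ 0 → ∀ i, ‖X i‖ ≤ R

namespace ContBddSupp

variable {ι κ : Type*}

lemma hasCompactSupport [Finite ι] {g : (ι → E3) → ℝ} (hg : ContBddSupp g) :
    HasCompactSupport g := by
  obtain ⟨-, R, hR⟩ := hg
  refine HasCompactSupport.intro
    (isCompact_univ_pi fun _ : ι => isCompact_closedBall (0 : E3) R) fun X hX => ?_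
  by_contra h
  exact hX fun i _ => by simpa using hR X h i

lemma integrable [Fintype ι] {g : (ι → E3) → ℝ} (hg : ContBddSupp g) : Integrable g :=
  hg.1.integrable_of_hasCompactSupport hg.hasCompactSupport

lemma comp_equiv {g : (ι → E3) → ℝ} (hg : ContBddSupp g) (e : ι ≃ κ) :
    ContBddSupp fun X : κ → E3 => g (X ∘ e) := by
  obtain ⟨hc, R, hR⟩ := hg
  refine ⟨hc.comp (by fun_prop), R, fun X hX k => ?_⟩
  simpa using hR _ hX (e.symm k)

lemma comp_insertAt [DecidableEq ι] {g : (ι → E3) → ℝ} (hg : ContBddSupp g) (j : ι) (x : E3) :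
    ContBddSupp fun Y => g (insertAt j x Y) := by
  obtain ⟨hc, R, hR⟩ := hg
  refine ⟨hc.comp (continuous_insertAt j x), R, fun Y hY i => ?_⟩
  simpa [insertAt_of_ne i.2] using hR _ hY i

end ContBddSupp

lemma IsWaveFunction.contBddSupp {N : ℕ} {ψ : (Fin N → E3) → (Fin N → Fin 2) → ℂ}
    (h : IsWaveFunction N ψ) : ContBddSupp fun X => nsq (ψ X) := by
  refine ⟨continuous_nsq.comp h.1.continuous, ?_⟩
  obtain ⟨R, hR⟩ := h.2.1.isCompact.isBounded.exists_norm_le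
  refine ⟨R, fun X hX i => (norm_le_pi_norm X i).trans (hR X (subset_tsupport _ ?_))⟩
  intro h0
  exact hX ((congrArg nsq h0).trans nsq_zero)

lemma rho_eq (N : ℕ) (ψ : (Fin N → E3) → (Fin N → Fin 2) → ℂ) (x : E3) :
    rho N ψ x = ∑ j, ∫ Y, nsq (ψ (insertAt j x Y)) := rfl

/-- The density is nonzero at each position of a configuration where the wave function is
nonzero. -/
lemma IsWaveFunction.rho_ne_zero {N : ℕ} {ψ : (Fin N → E3) → (Fin N → Fin 2) → ℂ}
    (h : IsWaveFunction N ψ) {X : Fin N → E3} {s : Fin N → Fin 2} (hX : ψ X s ≠ 0) (j : Fin N) :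
    X j ∈ Function.support (rho N ψ) := by
  have hg := h.contBddSupp.comp_insertAt j (X j)
  have hpos : 0 < ∫ Y, nsq (ψ (insertAt j (X j) Y)) := by
    refine hg.1.integral_pos_of_hasCompactSupport_nonneg_nonzero hg.hasCompactSupport
      (fun _ => nsq_nonneg _) (x := fun i => X i) ?_
    rw [insertAt_restrict]
    exact nsq_ne_zero hX
  have hle := Finset.single_le_sum (f := fun k => ∫ Y, nsq (ψ (insertAt k (X j) Y)))
    (fun k _ => integral_nonneg fun _ => nsq_nonneg _) (Finset.mem_univ j)
  rw [Function.mem_support, rho_eq]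
  exact (hpos.trans_le hle).ne'

lemma integral_comp_equiv {ι κ : Type*} [Fintype ι] [Fintype κ] (e : ι ≃ κ)
    (g : (ι → E3) → ℝ) : ∫ Y : κ → E3, g (Y ∘ e) = ∫ Z : ι → E3, g Z := by
  have h := volume_measurePreserving_piCongrLeft (fun _ : ι => E3) e.symm
  rw [← h.integral_comp' g]
  congr 1
  funext Y
  congr 1
  funext i
  have := MeasurableEquiv.piCongrLeft_apply_apply (β := fun _ : ι => E3) e.symm Y (e i)
  simp only [Equiv.symm_apply_apply] at this
  exact this.symm

lemma integral_sum_mul {α β : Type*} [Fintype α] [Fintype β]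
    (f : (α → E3) → ℝ) (g : (β → E3) → ℝ) :
    ∫ Z : α ⊕ β → E3, f (Z ∘ Sum.inl) * g (Z ∘ Sum.inr) = (∫ Y, f Y) * ∫ Y, g Y := by
  have h := volume_measurePreserving_sumPiEquivProdPi (fun _ : α ⊕ β => E3)
  rw [← integral_prod_mul, ← Measure.volume_eq_prod, ← h.integral_comp']
  rfl

/-- Permuting the arguments permutes the one-particle marginals. -/
lemma integral_insertAt_comp {ι κ : Type*} [Fintype ι] [Fintype κ] [DecidableEq ι] [DecidableEq κ]
    (e : ι ≃ κ) (i : ι) (x : E3) (g : (ι → E3) → ℝ) :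
    ∫ Y, g (insertAt (e i) x Y ∘ e) = ∫ Z, g (insertAt i x Z) := by
  let e' : { a : ι // a ≠ i } ≃ { b : κ // b ≠ e i } :=
    e.subtypeEquiv fun a => by simp
  rw [← integral_comp_equiv e']
  congr 1
  funext Y
  congr 1
  funext a
  by_cases h : a = i
  · subst h; simp [insertAt_self]
  · rw [Function.comp_apply, insertAt_of_ne (by simpa using h), insertAt_of_ne h]
    rfl

/-- The indices of a sum type other than `Sum.inl i`. -/
def sumNeInl {α β : Type*} (i : α) : { a : α // a ≠ i } ⊕ β ≃ { k : α ⊕ β // k ≠ Sum.inl i } where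
  toFun := Sum.elim (fun a => ⟨Sum.inl a, by simpa using a.2⟩) fun b => ⟨Sum.inr b, by simp⟩
  invFun
    | ⟨Sum.inl a, h⟩ => Sum.inl ⟨a, by simpa using h⟩
    | ⟨Sum.inr b, _⟩ => Sum.inr b
  left_inv := by rintro (_ | _) <;> rfl
  right_inv := by rintro ⟨_ | _, _⟩ <;> rfl

lemma integral_insertAt_inl {α β : Type*} [Fintype α] [Fintype β] [DecidableEq α] [DecidableEq β]
    (i : α) (x : E3) (f : (α → E3) → ℝ) (g : (β → E3) → ℝ) :
    ∫ Y, f (insertAt (Sum.inl i : α ⊕ β) x Y ∘ Sum.inl) *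
        g (insertAt (Sum.inl i : α ⊕ β) x Y ∘ Sum.inr) =
      (∫ Y, f (insertAt i x Y)) * ∫ Z, g Z := by
  rw [← integral_sum_mul, ← integral_comp_equiv (sumNeInl i)]
  congr 1
  funext Y
  congr 2
  funext a
  by_cases h : a = i
  · subst h; simp [insertAt_self]
  · rw [Function.comp_apply, insertAt_of_ne (by simpa using h), insertAt_of_ne h]
    rfl

lemma integral_insertAt_inr {α β : Type*} [Fintype α] [Fintype β] [DecidableEq α] [DecidableEq β]
    (i : β) (x : E3) (f : (α → E3) → ℝ) (g : (β → E3) → ℝ) :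
    ∫ Y, f (insertAt (Sum.inr i : α ⊕ β) x Y ∘ Sum.inl) *
        g (insertAt (Sum.inr i : α ⊕ β) x Y ∘ Sum.inr) =
      (∫ Z, f Z) * ∫ Y, g (insertAt i x Y) := by
  have h := integral_insertAt_comp (Equiv.sumComm β α) (Sum.inl i) x
    fun X => g (X ∘ Sum.inl) * f (X ∘ Sum.inr)
  rw [integral_insertAt_inl] at h
  rw [mul_comm (∫ Z, f Z), ← h]
  congr 1
  funext Y
  exact mul_comm _ _

/-- The tensor product of two wave functions. -/
def tensor (m n : ℕ) (φ : (Fin m → E3) → (Fin m → Fin 2) → ℂ)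
    (ψ : (Fin n → E3) → (Fin n → Fin 2) → ℂ) :
    (Fin (m + n) → E3) → (Fin (m + n) → Fin 2) → ℂ :=
  fun X s => φ (X ∘ Fin.castAdd n) (s ∘ Fin.castAdd n) * ψ (X ∘ Fin.natAdd m) (s ∘ Fin.natAdd m)

section Tensor

variable {m n : ℕ} {φ : (Fin m → E3) → (Fin m → Fin 2) → ℂ}
  {ψ : (Fin n → E3) → (Fin n → Fin 2) → ℂ}

lemma nsq_tensor (X : Fin (m + n) → E3) :
    nsq (tensor m n φ ψ X) = nsq (φ (X ∘ Fin.castAdd n)) * nsq (ψ (X ∘ Fin.natAdd m)) := by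
  simp only [nsq, tensor, Finset.sum_mul_sum, norm_mul, mul_pow]
  rw [← Fintype.sum_prod_type' fun s t => ‖φ (X ∘ Fin.castAdd n) s‖ ^ 2 *
    ‖ψ (X ∘ Fin.natAdd m) t‖ ^ 2]
  exact Fintype.sum_equiv (Fin.appendEquiv m n).symm _ _ fun s => rfl

lemma contBddSupp_nsq_tensor (hφ : IsWaveFunction m φ) (hψ : IsWaveFunction n ψ) :
    ContBddSupp fun X => nsq (tensor m n φ ψ X) := by
  simp only [nsq_tensor]
  obtain ⟨hc, R, hR⟩ := hφ.contBddSupp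
  obtain ⟨hc', R', hR'⟩ := hψ.contBddSupp
  refine ⟨(hc.comp (by fun_prop)).mul (hc'.comp (by fun_prop)), max R R', fun X hX i => ?_⟩
  obtain ⟨h1, h2⟩ := mul_ne_zero_iff.1 hX
  refine Fin.addCases (fun i => ?_) (fun i => ?_) i
  · exact (hR _ h1 i).trans (le_max_left _ _)
  · exact (hR' _ h2 i).trans (le_max_right _ _)

lemma integral_nsq_tensor :
    ∫ X, nsq (tensor m n φ ψ X) = (∫ X, nsq (φ X)) * ∫ X, nsq (ψ X) := by
  rw [← integral_sum_mul, ← integral_comp_equiv finSumFinEquiv]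
  simp only [nsq_tensor]
  rfl

lemma rho_tensor (x : E3) :
    rho (m + n) (tensor m n φ ψ) x =
      rho m φ x * (∫ X, nsq (ψ X)) + (∫ X, nsq (φ X)) * rho n ψ x := by
  simp only [rho_eq, nsq_tensor]
  rw [← finSumFinEquiv.sum_comp, Fintype.sum_sum_type, Finset.sum_mul, Finset.mul_sum]
  congr 1
  · refine Finset.sum_congr rfl fun i _ => ?_
    rw [← integral_insertAt_inl i x (fun X => nsq (φ X)) fun X => nsq (ψ X),
      ← integral_insertAt_comp finSumFinEquiv (Sum.inl i) x
        fun X => nsq (φ (X ∘ Sum.inl)) * nsq (ψ (X ∘ Sum.inr))]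
    rfl
  · refine Finset.sum_congr rfl fun i _ => ?_
    rw [← integral_insertAt_inr i x (fun X => nsq (φ X)) fun X => nsq (ψ X),
      ← integral_insertAt_comp finSumFinEquiv (Sum.inr i) x
        fun X => nsq (φ (X ∘ Sum.inl)) * nsq (ψ (X ∘ Sum.inr))]
    rfl

/-- The embedding of `S_m × S_n` in `S_{m+n}`. -/
def blockPerm (m n : ℕ) (p : Equiv.Perm (Fin m) × Equiv.Perm (Fin n)) :
    Equiv.Perm (Fin (m + n)) :=
  finSumFinEquiv.permCongr (Equiv.Perm.sumCongr p.1 p.2)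

lemma blockPerm_castAdd (p : Equiv.Perm (Fin m) × Equiv.Perm (Fin n)) (i : Fin m) :
    blockPerm m n p (Fin.castAdd n i) = Fin.castAdd n (p.1 i) := by
  simp [blockPerm, Equiv.permCongr_apply]

lemma blockPerm_natAdd (p : Equiv.Perm (Fin m) × Equiv.Perm (Fin n)) (i : Fin n) :
    blockPerm m n p (Fin.natAdd m i) = Fin.natAdd m (p.2 i) := by
  simp [blockPerm, Equiv.permCongr_apply]

lemma sign_blockPerm (p : Equiv.Perm (Fin m) × Equiv.Perm (Fin n)) :
    Equiv.Perm.sign (blockPerm m n p) = Equiv.Perm.sign p.1 * Equiv.Perm.sign p.2 := by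
  rw [blockPerm, Equiv.Perm.sign_permCongr, Equiv.Perm.sign_sumCongr]

lemma blockPerm_injective : Function.Injective (blockPerm m n) := by
  intro p q h
  refine Prod.ext (Equiv.ext fun i => ?_) (Equiv.ext fun i => ?_)
  · apply Fin.castAdd_injective m n
    rw [← blockPerm_castAdd, h, blockPerm_castAdd]
  · apply Fin.natAdd_injective n m
    rw [← blockPerm_natAdd, h, blockPerm_natAdd]

lemma exists_blockPerm_eq {σ : Equiv.Perm (Fin (m + n))}
    (h : ∀ i, σ (Fin.castAdd n i) ∈ Set.range (Fin.castAdd (m := n) (n := m))) :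
    ∃ p, blockPerm m n p = σ := by
  have hmem : finSumFinEquiv.symm.permCongr σ ∈
      (Equiv.Perm.sumCongrHom (Fin m) (Fin n)).range := by
    apply Equiv.Perm.mem_sumCongrHom_range_of_perm_mapsTo_inl
    rintro _ ⟨i, rfl⟩
    obtain ⟨k, hk⟩ := h i
    refine ⟨k, ?_⟩
    simp [Equiv.permCongr_apply, ← hk]
  obtain ⟨p, hp⟩ := hmem
  refine ⟨p, ?_⟩
  have h2 : Equiv.Perm.sumCongr p.1 p.2 = finSumFinEquiv.symm.permCongr σ := hp
  rw [blockPerm, h2]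
  ext i
  simp [Equiv.permCongr_apply]

lemma tensor_comp_blockPerm (hφ : IsWaveFunction m φ) (hψ : IsWaveFunction n ψ)
    (p : Equiv.Perm (Fin m) × Equiv.Perm (Fin n)) (X : Fin (m + n) → E3)
    (s : Fin (m + n) → Fin 2) :
    tensor m n φ ψ (X ∘ blockPerm m n p) (s ∘ blockPerm m n p) =
      ((Equiv.Perm.sign (blockPerm m n p) : ℤ) : ℂ) * tensor m n φ ψ X s := by
  have h1 : ∀ {γ : Type} (f : Fin (m + n) → γ),
      (f ∘ blockPerm m n p) ∘ Fin.castAdd n = (f ∘ Fin.castAdd n) ∘ p.1 := fun f => by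
    funext i; simp [blockPerm_castAdd]
  have h2 : ∀ {γ : Type} (f : Fin (m + n) → γ),
      (f ∘ blockPerm m n p) ∘ Fin.natAdd m = (f ∘ Fin.natAdd m) ∘ p.2 := fun f => by
    funext i; simp [blockPerm_natAdd]
  simp only [tensor, h1, h2, hφ.2.2, hψ.2.2, sign_blockPerm]
  push_cast
  ring

/-- The summands of the antisymmetrized product. -/
def wedgeTerm (φ : (Fin m → E3) → (Fin m → Fin 2) → ℂ) (ψ : (Fin n → E3) → (Fin n → Fin 2) → ℂ)
    (X : Fin (m + n) → E3) (s : Fin (m + n) → Fin 2) (σ : Equiv.Perm (Fin (m + n))) : ℂ :=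
  ((Equiv.Perm.sign σ : ℤ) : ℂ) * tensor m n φ ψ (X ∘ σ) (s ∘ σ)

lemma wedge_eq (X : Fin (m + n) → E3) (s : Fin (m + n) → Fin 2) :
    wedge m n φ ψ X s = (((m + n).factorial : ℂ))⁻¹ * ∑ σ, wedgeTerm φ ψ X s σ := rfl

lemma norm_wedgeTerm (X : Fin (m + n) → E3) (s : Fin (m + n) → Fin 2)
    (σ : Equiv.Perm (Fin (m + n))) :
    ‖wedgeTerm φ ψ X s σ‖ = ‖tensor m n φ ψ (X ∘ σ) (s ∘ σ)‖ := by
  rcases Int.units_eq_one_or (Equiv.Perm.sign σ) with h | h <;> simp [wedgeTerm, h]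

lemma wedgeTerm_mul_blockPerm (hφ : IsWaveFunction m φ) (hψ : IsWaveFunction n ψ)
    (p : Equiv.Perm (Fin m) × Equiv.Perm (Fin n)) (X : Fin (m + n) → E3)
    (s : Fin (m + n) → Fin 2) (σ : Equiv.Perm (Fin (m + n))) :
    wedgeTerm φ ψ X s (σ * blockPerm m n p) = wedgeTerm φ ψ X s σ := by
  have h := tensor_comp_blockPerm hφ hψ p (X ∘ σ) (s ∘ σ)
  simp only [wedgeTerm, Equiv.Perm.coe_mul, ← Function.comp_assoc, h, Equiv.Perm.sign_mul]
  rcases Int.units_eq_one_or (Equiv.Perm.sign (blockPerm m n p)) with h | h <;> simp [h]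

/-- If the densities have disjoint supports, two nonvanishing summands of the antisymmetrized
product differ by an element of `S_m × S_n`. -/
lemma exists_eq_mul_blockPerm (hφ : IsWaveFunction m φ) (hψ : IsWaveFunction n ψ)
    (hdisj : Disjoint (Function.support (rho m φ)) (Function.support (rho n ψ)))
    {X : Fin (m + n) → E3} {s : Fin (m + n) → Fin 2} {σ τ : Equiv.Perm (Fin (m + n))}
    (hσ : wedgeTerm φ ψ X s σ ≠ 0) (hτ : wedgeTerm φ ψ X s τ ≠ 0) :
    ∃ p, σ * blockPerm m n p = τ := by
  suffices h : ∃ p, blockPerm m n p = σ⁻¹ * τ by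
    obtain ⟨p, hp⟩ := h
    exact ⟨p, by rw [hp, mul_inv_cancel_left]⟩
  apply exists_blockPerm_eq
  intro i
  have hσ' := (mul_ne_zero_iff.1 (mul_ne_zero_iff.1 hσ).2).2
  have hτ' := (mul_ne_zero_iff.1 (mul_ne_zero_iff.1 hτ).2).1
  have hi : X (τ (Fin.castAdd n i)) ∈ Function.support (rho m φ) := hφ.rho_ne_zero hτ' i
  rw [Equiv.Perm.mul_apply]
  obtain ⟨k, hk⟩ : ∃ k, σ⁻¹ (τ (Fin.castAdd n i)) = k := ⟨_, rfl⟩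
  rw [hk]
  rw [Equiv.Perm.inv_eq_iff_eq] at hk
  revert hk
  refine Fin.addCases (fun k _ => ⟨k, rfl⟩) (fun k hk => ?_) k
  refine (Set.disjoint_left.1 hdisj hi ?_).elim
  rw [hk]
  exact hψ.rho_ne_zero hσ' k

lemma sum_wedgeTerm {M : Type*} [AddCommMonoid M] (F : ℂ → M) (hF : F 0 = 0)
    (hφ : IsWaveFunction m φ) (hψ : IsWaveFunction n ψ)
    (hdisj : Disjoint (Function.support (rho m φ)) (Function.support (rho n ψ)))
    {X : Fin (m + n) → E3} {s : Fin (m + n) → Fin 2} {σ : Equiv.Perm (Fin (m + n))}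
    (hσ : wedgeTerm φ ψ X s σ ≠ 0) :
    ∑ τ, F (wedgeTerm φ ψ X s τ) =
      (m.factorial * n.factorial) • F (wedgeTerm φ ψ X s σ) := by
  rw [← Fintype.sum_of_injective (fun p => σ * blockPerm m n p)
    ((mul_right_injective σ).comp blockPerm_injective) (fun _ => F (wedgeTerm φ ψ X s σ))]
  · simp [Fintype.card_perm]
  · intro τ hτ
    by_contra h
    refine hτ (exists_eq_mul_blockPerm hφ hψ hdisj hσ fun h0 => h ?_)
    rw [h0, hF]
  · intro p
    rw [wedgeTerm_mul_blockPerm hφ hψ]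

lemma norm_sum_wedgeTerm_sq (hφ : IsWaveFunction m φ) (hψ : IsWaveFunction n ψ)
    (hdisj : Disjoint (Function.support (rho m φ)) (Function.support (rho n ψ)))
    (X : Fin (m + n) → E3) (s : Fin (m + n) → Fin 2) :
    ‖∑ σ, wedgeTerm φ ψ X s σ‖ ^ 2 =
      (m.factorial * n.factorial : ℝ) * ∑ σ, ‖wedgeTerm φ ψ X s σ‖ ^ 2 := by
  by_cases h : ∀ σ, wedgeTerm φ ψ X s σ = 0
  · simp [h]
  · push Not at h
    obtain ⟨σ, hσ⟩ := h
    have h1 := sum_wedgeTerm id rfl hφ hψ hdisj hσ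
    have h2 := sum_wedgeTerm (fun z => ‖z‖ ^ 2) (by simp) hφ hψ hdisj hσ
    simp only [id] at h1
    rw [h1, h2, nsmul_eq_mul, nsmul_eq_mul, norm_mul, Complex.norm_natCast]
    push_cast
    ring

lemma nsq_wedge (hφ : IsWaveFunction m φ) (hψ : IsWaveFunction n ψ)
    (hdisj : Disjoint (Function.support (rho m φ)) (Function.support (rho n ψ)))
    (X : Fin (m + n) → E3) :
    nsq (wedge m n φ ψ X) = (m.factorial * n.factorial : ℝ) / ((m + n).factorial : ℝ) ^ 2 *
      ∑ σ : Equiv.Perm (Fin (m + n)), nsq (tensor m n φ ψ (X ∘ σ)) := by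
  have h : ∀ s, ‖wedge m n φ ψ X s‖ ^ 2 =
      (m.factorial * n.factorial : ℝ) / ((m + n).factorial : ℝ) ^ 2 *
        ∑ σ : Equiv.Perm (Fin (m + n)), ‖tensor m n φ ψ (X ∘ σ) (s ∘ σ)‖ ^ 2 := fun s => by
    rw [wedge_eq, norm_mul, mul_pow, norm_sum_wedgeTerm_sq hφ hψ hdisj, norm_inv,
      Complex.norm_natCast]
    simp only [norm_wedgeTerm]
    ring
  rw [nsq, Finset.sum_congr rfl fun s _ => h s, ← Finset.mul_sum, Finset.sum_comm]
  congr 1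
  refine Finset.sum_congr rfl fun σ _ => ?_
  exact Fintype.sum_equiv (σ.symm.arrowCongr (Equiv.refl _)) _ _ fun s => rfl

lemma integral_nsq_wedge (hφ : IsWaveFunction m φ) (hψ : IsWaveFunction n ψ)
    (hdisj : Disjoint (Function.support (rho m φ)) (Function.support (rho n ψ))) :
    ∫ X, nsq (wedge m n φ ψ X) = (m.factorial * n.factorial : ℝ) / (m + n).factorial *
      ((∫ X, nsq (φ X)) * ∫ X, nsq (ψ X)) := by
  have hT := contBddSupp_nsq_tensor hφ hψ
  have hN : ((m + n).factorial : ℝ) ≠ 0 := by positivity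
  simp only [nsq_wedge hφ hψ hdisj]
  rw [integral_const_mul, integral_finsetSum _ fun σ _ => (hT.comp_equiv σ).integrable,
    Finset.sum_congr rfl fun σ _ => integral_comp_equiv σ fun X => nsq (tensor m n φ ψ X),
    integral_nsq_tensor]
  simp only [Finset.sum_const, Finset.card_univ, Fintype.card_perm, Fintype.card_fin, nsmul_eq_mul]
  field_simp

lemma rho_wedge (hφ : IsWaveFunction m φ) (hψ : IsWaveFunction n ψ)
    (hdisj : Disjoint (Function.support (rho m φ)) (Function.support (rho n ψ))) (x : E3) :
    rho (m + n) (wedge m n φ ψ) x = (m.factorial * n.factorial : ℝ) / (m + n).factorial *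
      rho (m + n) (tensor m n φ ψ) x := by
  have hT := contBddSupp_nsq_tensor hφ hψ
  have hN : ((m + n).factorial : ℝ) ≠ 0 := by positivity
  simp only [rho_eq, nsq_wedge hφ hψ hdisj]
  have h : ∀ j : Fin (m + n), ∫ Y, (m.factorial * n.factorial : ℝ) / ((m + n).factorial : ℝ) ^ 2 *
        ∑ σ : Equiv.Perm (Fin (m + n)), nsq (tensor m n φ ψ (insertAt j x Y ∘ σ)) =
      (m.factorial * n.factorial : ℝ) / ((m + n).factorial : ℝ) ^ 2 *
        ∑ σ : Equiv.Perm (Fin (m + n)), ∫ Y, nsq (tensor m n φ ψ (insertAt j x Y ∘ σ)) := fun j => by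
    rw [integral_const_mul,
      integral_finsetSum _ fun σ _ => ((hT.comp_equiv σ).comp_insertAt j x).integrable]
  have h2 : ∀ σ : Equiv.Perm (Fin (m + n)),
      ∑ j, ∫ Y, nsq (tensor m n φ ψ (insertAt j x Y ∘ σ)) =
        ∑ j, ∫ Y, nsq (tensor m n φ ψ (insertAt j x Y)) := fun σ => by
    rw [← Equiv.sum_comp σ]
    exact Finset.sum_congr rfl fun j _ =>
      integral_insertAt_comp σ j x fun X => nsq (tensor m n φ ψ X)
  rw [Finset.sum_congr rfl fun j _ => h j, ← Finset.mul_sum, Finset.sum_comm,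
    Finset.sum_congr rfl fun σ _ => h2 σ]
  simp only [Finset.sum_const, Finset.card_univ, Fintype.card_perm, Fintype.card_fin, nsmul_eq_mul]
  field_simp

end Tensor

lemma rho_const_mul {N : ℕ} (c : ℂ) (ψ : (Fin N → E3) → (Fin N → Fin 2) → ℂ) (x : E3) :
    rho N (fun X s => c * ψ X s) x = ‖c‖ ^ 2 * rho N ψ x := by
  simp only [rho_eq, nsq_smul, integral_const_mul, Finset.mul_sum]

/-- if the densities of normalized wave functions `φ` and `ψ` have disjoint
supports, then `‖φ∧ψ‖² = m!n!/(m+n)!` (in particular `φ∧ψ ≠ 0`) and the density of the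
normalized function `Φ = (φ∧ψ)/‖φ∧ψ‖` is `ρ_Φ = ρ_φ + ρ_ψ`. -/
theorem wedge_norm_and_density (m n : ℕ)
    (φ : (Fin m → E3) → (Fin m → Fin 2) → ℂ)
    (ψ : (Fin n → E3) → (Fin n → Fin 2) → ℂ)
    (hφ : IsWaveFunction m φ) (hψ : IsWaveFunction n ψ)
    (hφ1 : (∫ X : Fin m → E3, nsq (φ X)) = 1)
    (hψ1 : (∫ X : Fin n → E3, nsq (ψ X)) = 1)
    (hdisj : Disjoint (Function.support (rho m φ)) (Function.support (rho n ψ))) :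
    (∫ X : Fin (m + n) → E3, nsq (wedge m n φ ψ X)) =
        (m.factorial : ℝ) * n.factorial / (m + n).factorial ∧
    wedge m n φ ψ ≠ 0 ∧
    ∀ x : E3,
      rho (m + n)
          (fun X s =>
            ((Real.sqrt (∫ X' : Fin (m + n) → E3, nsq (wedge m n φ ψ X')))⁻¹ : ℝ) *
              wedge m n φ ψ X s) x =
        rho m φ x + rho n ψ x := by
  have hI : (∫ X : Fin (m + n) → E3, nsq (wedge m n φ ψ X)) =
      (m.factorial : ℝ) * n.factorial / (m + n).factorial := by
    rw [integral_nsq_wedge hφ hψ hdisj, hφ1, hψ1, mul_one, mul_one]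
  have hpos : 0 < (m.factorial : ℝ) * n.factorial / (m + n).factorial := by positivity
  refine ⟨hI, fun h0 => ?_, fun x => ?_⟩
  · rw [h0] at hI
    simp only [Pi.zero_apply, nsq_zero, integral_zero] at hI
    exact hpos.ne hI
  · rw [rho_const_mul, rho_wedge hφ hψ hdisj, rho_tensor, hφ1, hψ1, hI, Complex.norm_real,
      norm_inv, inv_pow, Real.norm_eq_abs, sq_abs, Real.sq_sqrt hpos.le,
      inv_mul_cancel_left₀ hpos.ne', mul_one, one_mul]

end
end

section
/- For every N ∈ ℕ and every ε > 0 there exists C_ε ∈ ℝ such that for all ψ ∈ C_c^∞(ℝ^{3N};ℂ): ∑_{1 ≤ i < j ≤ N} ∫_{ℝ^{3N}} |ψ(x₁,…,x_N)|² / |x_i − x_j| dx₁⋯dx_N ≤ ε ∫_{ℝ^{3N}} |∇ψ|² + C_ε ∫_{ℝ^{3N}} |ψ|². In other words, the Coulomb repulsion V_C(x₁,…,x_N) = ∑_{i<j} 1/|x_i−x_j| is infinitesimally form-bounded with respect to the Dirichlet form ∑_{j=1}^N ⟨∇_{x_j}ψ, ∇_{x_j}ψ⟩. -/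
open MeasureTheory Metric Finset

noncomputable section

/-- The coordinates of the regularised radial field `x / √(‖x‖² + η)` on `ℝ³`. -/
def radialField (η : ℝ) (k : Fin 3) (x : E3) : ℝ := x k / √(‖x‖ ^ 2 + η)

/-- The `k`-th partial derivative of `radialField η k`. -/
def radialFieldDeriv (η : ℝ) (k : Fin 3) (x : E3) : ℝ :=
  (√(‖x‖ ^ 2 + η) - x k * (x k / √(‖x‖ ^ 2 + η))) / √(‖x‖ ^ 2 + η) ^ 2

lemma continuous_radialField {η : ℝ} (hη : 0 < η) (k : Fin 3) :
    Continuous (radialField η k) := by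
  unfold radialField
  have h (x : E3) : √(‖x‖ ^ 2 + η) ≠ 0 := by positivity
  fun_prop (disch := exact h _)

lemma continuous_radialFieldDeriv {η : ℝ} (hη : 0 < η) (k : Fin 3) :
    Continuous (radialFieldDeriv η k) := by
  unfold radialFieldDeriv
  have h (x : E3) : √(‖x‖ ^ 2 + η) ≠ 0 := by positivity
  have h₂ (x : E3) : √(‖x‖ ^ 2 + η) ^ 2 ≠ 0 := by positivity
  fun_prop (disch := first | exact h _ | exact h₂ _)

lemma hasDerivAt_radialField {η : ℝ} (hη : 0 < η) (k : Fin 3) (x : E3) :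
    HasDerivAt (fun t : ℝ => radialField η k (x + t • EuclideanSpace.single k (1 : ℝ)))
      (radialFieldDeriv η k x) 0 := by
  have hline : HasDerivAt (fun t : ℝ => x + t • EuclideanSpace.single k (1 : ℝ))
      (EuclideanSpace.single k (1 : ℝ)) 0 := by
    simpa using ((hasDerivAt_id (0 : ℝ)).smul_const
      (EuclideanSpace.single k (1 : ℝ))).const_add x
  have hsqrt := (hline.norm_sq.add_const η).sqrt (by simp; positivity)
  have hcoord : HasDerivAt (fun t : ℝ => (x + t • EuclideanSpace.single k (1 : ℝ)) k) 1 0 := by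
    simpa using (hasDerivAt_id (0 : ℝ)).const_add (x k)
  have h0 : √(‖x‖ ^ 2 + η) ≠ 0 := by positivity
  have hdiv := hcoord.fun_div hsqrt (by simpa using h0)
  refine hdiv.congr_deriv ?_
  simp [radialFieldDeriv, EuclideanSpace.inner_single_right]
  field_simp

lemma sum_sq_radialField_le_one {η : ℝ} (hη : 0 < η) (x : E3) :
    ∑ k, radialField η k x ^ 2 ≤ 1 := by
  have h0 : 0 < ‖x‖ ^ 2 + η := by positivity
  simp_rw [radialField, div_pow, Real.sq_sqrt h0.le, ← Finset.sum_div]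
  rw [div_le_one h0, ← EuclideanSpace.real_norm_sq_eq]
  linarith

lemma two_mul_norm_div_le_sum_radialFieldDeriv {η : ℝ} (hη : 0 < η) (x : E3) :
    2 * (‖x‖ / (‖x‖ ^ 2 + η)) ≤ ∑ k, radialFieldDeriv η k x := by
  have h0 : 0 < ‖x‖ ^ 2 + η := by positivity
  have hs : 0 < √(‖x‖ ^ 2 + η) := by positivity
  have hsq : √(‖x‖ ^ 2 + η) ^ 2 = ‖x‖ ^ 2 + η := Real.sq_sqrt h0.le
  have hx := EuclideanSpace.real_norm_sq_eq x
  rw [Fin.sum_univ_three] at hx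
  have hle : ‖x‖ ≤ √(‖x‖ ^ 2 + η) := Real.le_sqrt_of_sq_le (by linarith)
  have hsum : ∑ k, radialFieldDeriv η k x
      = (3 * √(‖x‖ ^ 2 + η) - ‖x‖ ^ 2 / √(‖x‖ ^ 2 + η)) / (‖x‖ ^ 2 + η) := by
    simp only [Fin.sum_univ_three, radialFieldDeriv, hsq]
    rw [congrArg (· / √(‖x‖ ^ 2 + η)) hx]
    ring
  rw [hsum, ← mul_div_assoc]
  gcongr
  have : ‖x‖ ^ 2 / √(‖x‖ ^ 2 + η) ≤ √(‖x‖ ^ 2 + η) := by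
    rw [div_le_iff₀ hs]; nlinarith
  linarith

section Pair

variable {N : ℕ} {ψ : (Fin N → E3) → ℂ}

lemma hasLineDerivAt_radialField_sub {η : ℝ} (hη : 0 < η) (k : Fin 3) {i j : Fin N} (hij : i ≠ j)
    (X : Fin N → E3) :
    HasLineDerivAt ℝ (fun X : Fin N → E3 => radialField η k (X i - X j))
      (radialFieldDeriv η k (X i - X j)) X (Pi.single i (EuclideanSpace.single k 1)) := by
  have h (e : E3) (t : ℝ) : (X + t • (Pi.single i e : Fin N → E3)) i
      - (X + t • (Pi.single i e : Fin N → E3)) j = X i - X j + t • e := by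
    simp only [Pi.add_apply, Pi.smul_apply, Pi.single_eq_same, Pi.single_eq_of_ne hij.symm,
      smul_zero, add_zero]
    abel
  simpa only [HasLineDerivAt, h] using hasDerivAt_radialField hη k (X i - X j)

lemma hasLineDerivAt_norm_sq (hψ : ContDiff ℝ (⊤ : ℕ∞) ψ) (X v : Fin N → E3) :
    HasLineDerivAt ℝ (fun X => ‖ψ X‖ ^ 2) (2 * inner ℝ (ψ X) (fderiv ℝ ψ X v)) X v := by
  simpa [mul_add] using
    ((hψ.differentiable (by simp)).differentiableAt (x := X)).hasFDerivAt.norm_sq.hasLineDerivAt v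

lemma integrable_norm_sq_fderiv (hψ : ContDiff ℝ (⊤ : ℕ∞) ψ) (hc : HasCompactSupport ψ)
    (v : Fin N → E3) : Integrable fun X => ‖fderiv ℝ ψ X v‖ ^ 2 := by
  have hd : Continuous fun X => fderiv ℝ ψ X v :=
    (hψ.continuous_fderiv (by simp)).clm_apply continuous_const
  have hdc : HasCompactSupport fun X => fderiv ℝ ψ X v := hc.fderiv_apply ℝ v
  refine (hd.norm.pow 2).integrable_of_hasCompactSupport (hdc.mono fun X hX hX0 => hX ?_)
  simp [hX0]

lemma integrable_mul_norm_sq (hψ : ContDiff ℝ (⊤ : ℕ∞) ψ) (hc : HasCompactSupport ψ)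
    {w : (Fin N → E3) → ℝ} (hw : Continuous w) : Integrable fun X => w X * ‖ψ X‖ ^ 2 := by
  refine (hw.mul (hψ.continuous.norm.pow 2)).integrable_of_hasCompactSupport
    (hc.mono fun X hX hX0 => hX ?_)
  simp [hX0]

lemma integral_radialFieldDeriv_mul_le (hψ : ContDiff ℝ (⊤ : ℕ∞) ψ) (hc : HasCompactSupport ψ)
    {η : ℝ} (hη : 0 < η) {δ : ℝ} (hδ : 0 < δ) (k : Fin 3) {i j : Fin N} (hij : i ≠ j) :
    ∫ X, radialFieldDeriv η k (X i - X j) * ‖ψ X‖ ^ 2 ≤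
      ∫ X, (δ * ‖fderiv ℝ ψ X (Pi.single i (EuclideanSpace.single k 1))‖ ^ 2
        + δ⁻¹ * (radialField η k (X i - X j) ^ 2 * ‖ψ X‖ ^ 2)) := by
  set v : Fin N → E3 := Pi.single i (EuclideanSpace.single k 1)
  have hG : Continuous fun X : Fin N → E3 => radialField η k (X i - X j) :=
    (continuous_radialField hη k).comp (by fun_prop)
  have hG' : Continuous fun X : Fin N → E3 => radialFieldDeriv η k (X i - X j) :=
    (continuous_radialFieldDeriv hη k).comp (by fun_prop)
  have hψc := hψ.continuous
  have hd : Continuous fun X => fderiv ℝ ψ X v :=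
    (hψ.continuous_fderiv (by simp)).clm_apply continuous_const
  have hu' : HasCompactSupport fun X => 2 * inner ℝ (ψ X) (fderiv ℝ ψ X v) := by
    refine hc.mono fun X hX hX0 => hX ?_
    simp [hX0]
  have hGu' : Integrable fun X : Fin N → E3 =>
      radialField η k (X i - X j) * (2 * inner ℝ (ψ X) (fderiv ℝ ψ X v)) :=
    (hG.mul (by fun_prop)).integrable_of_hasCompactSupport hu'.mul_left
  have hparts := integral_bilinear_hasLineDerivAt_right_eq_neg_left_of_integrable
    (μ := (volume : Measure (Fin N → E3))) (B := ContinuousLinearMap.mul ℝ ℝ)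
    (f := fun X => radialField η k (X i - X j)) (g := fun X => ‖ψ X‖ ^ 2)
    (f' := fun X => radialFieldDeriv η k (X i - X j))
    (g' := fun X => 2 * inner ℝ (ψ X) (fderiv ℝ ψ X v)) (v := v)
    (integrable_mul_norm_sq hψ hc hG') hGu' (integrable_mul_norm_sq hψ hc hG)
    (fun X _ => hasLineDerivAt_radialField_sub hη k hij X)
    (fun X _ => hasLineDerivAt_norm_sq hψ X v)
  simp only [ContinuousLinearMap.mul_apply'] at hparts
  rw [eq_neg_iff_add_eq_zero, add_comm, ← eq_neg_iff_add_eq_zero, ← integral_neg] at hparts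
  rw [hparts]
  refine integral_mono hGu'.neg
    (((integrable_norm_sq_fderiv hψ hc v).const_mul δ).add
      ((integrable_mul_norm_sq hψ hc (hG.pow 2)).const_mul δ⁻¹)) fun X => ?_
  have hcs := abs_real_inner_le_norm (ψ X) (fderiv ℝ ψ X v)
  set g := radialField η k (X i - X j)
  set a := ‖fderiv ℝ ψ X v‖
  set b := ‖ψ X‖
  have h1 : -(g * (2 * inner ℝ (ψ X) (fderiv ℝ ψ X v))) ≤ 2 * (|g| * b) * a := by
    refine (neg_le_abs _).trans ?_
    rw [abs_mul, abs_mul, abs_two]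
    nlinarith [mul_le_mul_of_nonneg_left hcs (abs_nonneg g)]
  have h2 : 2 * (|g| * b) * a ≤ δ * a ^ 2 + δ⁻¹ * (g ^ 2 * b ^ 2) := by
    have h : δ * a ^ 2 + δ⁻¹ * (g ^ 2 * b ^ 2) - 2 * (|g| * b) * a
        = δ⁻¹ * (δ * a - |g| * b) ^ 2 := by
      rw [← sq_abs g]; field_simp; ring
    have : 0 ≤ δ⁻¹ * (δ * a - |g| * b) ^ 2 := by positivity
    linarith
  exact h1.trans h2

/-- The contribution of the `i`-th particle to `|∇ψ|²`. -/
def gradSq (ψ : (Fin N → E3) → ℂ) (i : Fin N) (X : Fin N → E3) : ℝ :=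
  ∑ k : Fin 3, ‖fderiv ℝ ψ X (Pi.single i (EuclideanSpace.single k 1))‖ ^ 2

lemma continuous_dist_div_sq_add {η : ℝ} (hη : 0 < η) (i j : Fin N) :
    Continuous fun X : Fin N → E3 => dist (X i) (X j) / (dist (X i) (X j) ^ 2 + η) := by
  have h (X : Fin N → E3) : dist (X i) (X j) ^ 2 + η ≠ 0 := by positivity
  fun_prop (disch := exact h _)

lemma integral_regularized_le (hψ : ContDiff ℝ (⊤ : ℕ∞) ψ) (hc : HasCompactSupport ψ)
    {η : ℝ} (hη : 0 < η) {δ : ℝ} (hδ : 0 < δ) {i j : Fin N} (hij : i ≠ j) :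
    2 * ∫ X, dist (X i) (X j) / (dist (X i) (X j) ^ 2 + η) * ‖ψ X‖ ^ 2 ≤
      δ * (∫ X, gradSq ψ i X) + δ⁻¹ * ∫ X, ‖ψ X‖ ^ 2 := by
  have hG (k) : Continuous fun X : Fin N → E3 => radialField η k (X i - X j) :=
    (continuous_radialField hη k).comp (by fun_prop)
  have hG' (k) : Continuous fun X : Fin N → E3 => radialFieldDeriv η k (X i - X j) :=
    (continuous_radialFieldDeriv hη k).comp (by fun_prop)
  have hL2 : Integrable fun X => ‖ψ X‖ ^ 2 := by
    simpa using integrable_mul_norm_sq hψ hc continuous_const (w := fun _ => 1)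
  have hreg := continuous_dist_div_sq_add hη i j
  have hgrad : Integrable (gradSq ψ i) :=
    integrable_finsetSum _ fun k _ => integrable_norm_sq_fderiv hψ hc _
  have hint (k : Fin 3) : Integrable fun X =>
      δ * ‖fderiv ℝ ψ X (Pi.single i (EuclideanSpace.single k 1))‖ ^ 2
        + δ⁻¹ * (radialField η k (X i - X j) ^ 2 * ‖ψ X‖ ^ 2) :=
    ((integrable_norm_sq_fderiv hψ hc _).const_mul δ).add
      ((integrable_mul_norm_sq hψ hc ((hG k).pow 2)).const_mul δ⁻¹)
  calc 2 * ∫ X, dist (X i) (X j) / (dist (X i) (X j) ^ 2 + η) * ‖ψ X‖ ^ 2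
      = ∫ X, 2 * (dist (X i) (X j) / (dist (X i) (X j) ^ 2 + η) * ‖ψ X‖ ^ 2) := by
        rw [integral_const_mul]
    _ ≤ ∫ X, ∑ k, radialFieldDeriv η k (X i - X j) * ‖ψ X‖ ^ 2 := by
        refine integral_mono ((integrable_mul_norm_sq hψ hc hreg).const_mul 2)
          (integrable_finsetSum _ fun k _ => integrable_mul_norm_sq hψ hc (hG' k)) fun X => ?_
        simp only [← Finset.sum_mul, ← mul_assoc, dist_eq_norm]
        gcongr
        exact two_mul_norm_div_le_sum_radialFieldDeriv hη _
    _ = ∑ k, ∫ X, radialFieldDeriv η k (X i - X j) * ‖ψ X‖ ^ 2 :=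
        integral_finsetSum _ fun k _ => integrable_mul_norm_sq hψ hc (hG' k)
    _ ≤ ∑ k, ∫ X, (δ * ‖fderiv ℝ ψ X (Pi.single i (EuclideanSpace.single k 1))‖ ^ 2
          + δ⁻¹ * (radialField η k (X i - X j) ^ 2 * ‖ψ X‖ ^ 2)) :=
        Finset.sum_le_sum fun k _ => integral_radialFieldDeriv_mul_le hψ hc hη hδ k hij
    _ = ∫ X, ∑ k, (δ * ‖fderiv ℝ ψ X (Pi.single i (EuclideanSpace.single k 1))‖ ^ 2
          + δ⁻¹ * (radialField η k (X i - X j) ^ 2 * ‖ψ X‖ ^ 2)) :=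
        (integral_finsetSum _ fun k _ => hint k).symm
    _ ≤ ∫ X, (δ * gradSq ψ i X + δ⁻¹ * ‖ψ X‖ ^ 2) := by
        refine integral_mono (integrable_finsetSum _ fun k _ => hint k)
          ((hgrad.const_mul δ).add (hL2.const_mul δ⁻¹)) fun X => ?_
        simp only [Finset.sum_add_distrib, ← Finset.mul_sum, ← Finset.sum_mul, gradSq]
        gcongr
        exact mul_le_of_le_one_left (by positivity) (sum_sq_radialField_le_one hη _)
    _ = δ * (∫ X, gradSq ψ i X) + δ⁻¹ * ∫ X, ‖ψ X‖ ^ 2 := by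
        rw [integral_add (hgrad.const_mul δ) (hL2.const_mul δ⁻¹), integral_const_mul,
          integral_const_mul]

lemma integral_norm_sq_div_dist_le (hψ : ContDiff ℝ (⊤ : ℕ∞) ψ) (hc : HasCompactSupport ψ)
    {δ : ℝ} (hδ : 0 < δ) {i j : Fin N} (hij : i ≠ j) :
    2 * ∫ X, ‖ψ X‖ ^ 2 / dist (X i) (X j) ≤
      δ * (∫ X, gradSq ψ i X) + δ⁻¹ * ∫ X, ‖ψ X‖ ^ 2 := by
  by_cases hint : Integrable fun X => ‖ψ X‖ ^ 2 / dist (X i) (X j)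
  swap
  · rw [integral_undef hint, mul_zero]
    have h1 : 0 ≤ ∫ X, gradSq ψ i X := integral_nonneg fun X => by
      unfold gradSq; positivity
    have h2 : 0 ≤ ∫ X, ‖ψ X‖ ^ 2 := integral_nonneg fun X => by positivity
    positivity
  have hlim : Filter.Tendsto
      (fun η : ℝ => ∫ X, dist (X i) (X j) / (dist (X i) (X j) ^ 2 + η) * ‖ψ X‖ ^ 2)
      (nhdsWithin 0 (Set.Ioi 0)) (nhds (∫ X, ‖ψ X‖ ^ 2 / dist (X i) (X j))) := by
    refine tendsto_integral_filter_of_dominated_convergence _ ?_ ?_ hint ?_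
    · filter_upwards [self_mem_nhdsWithin] with η hη
      exact (integrable_mul_norm_sq hψ hc (continuous_dist_div_sq_add hη i j)).1
    · filter_upwards [self_mem_nhdsWithin] with η (hη : 0 < η)
      refine Filter.Eventually.of_forall fun X => ?_
      rw [Real.norm_of_nonneg (by positivity), div_eq_inv_mul (‖ψ X‖ ^ 2)]
      gcongr
      rcases eq_or_ne (dist (X i) (X j)) 0 with h | h
      · simp [h]
      · have h' : 0 < dist (X i) (X j) := lt_of_le_of_ne dist_nonneg h.symm
        rw [div_le_iff₀ (by positivity), inv_mul_eq_div, le_div_iff₀ h']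
        nlinarith
    · refine Filter.Eventually.of_forall fun X => ?_
      refine tendsto_nhdsWithin_of_tendsto_nhds ?_
      rcases eq_or_ne (dist (X i) (X j)) 0 with h | h
      · simp [h]
      · have hcont : ContinuousAt
            (fun η : ℝ => dist (X i) (X j) / (dist (X i) (X j) ^ 2 + η) * ‖ψ X‖ ^ 2) 0 := by
          have : dist (X i) (X j) ^ 2 + 0 ≠ 0 := by simpa using h
          fun_prop (disch := assumption)
        convert hcont.tendsto using 2
        field_simp
        simp
  refine le_of_tendsto (hlim.const_mul 2) ?_
  filter_upwards [self_mem_nhdsWithin] with η hη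
  exact integral_regularized_le hψ hc hη hδ hij

end Pair

/-- the Coulomb repulsion `∑_{i<j} 1/|x_i−x_j|` is infinitesimally
form-bounded with respect to the Dirichlet form on `ℝ^(3N)`: for every `ε > 0` there is
`C_ε` with `∑_{i<j} ∫ |ψ|²/|x_i−x_j| ≤ ε ∫ |∇ψ|² + C_ε ∫ |ψ|²` for all
`ψ ∈ C_c^∞(ℝ^(3N);ℂ)`. -/
theorem coulomb_infinitesimally_form_bounded (N : ℕ) :
    ∀ ε > (0 : ℝ), ∃ C : ℝ,
      ∀ ψ : (Fin N → E3) → ℂ, ContDiff ℝ (⊤ : ℕ∞) ψ → HasCompactSupport ψ →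
        (∑ p ∈ Finset.univ.filter (fun p : Fin N × Fin N => p.1 < p.2),
            ∫ X : Fin N → E3, ‖ψ X‖ ^ 2 / dist (X p.1) (X p.2)) ≤
          ε * (∫ X : Fin N → E3, ∑ j : Fin N, ∑ k : Fin 3,
              ‖fderiv ℝ ψ X (Pi.single j (EuclideanSpace.single k 1))‖ ^ 2)
            + C * (∫ X : Fin N → E3, ‖ψ X‖ ^ 2) := by
  intro ε hε
  set δ : ℝ := ε / (N ^ 2 + 1)
  have hδ : 0 < δ := by positivity
  refine ⟨N ^ 2 * δ⁻¹, fun ψ hψ hc => ?_⟩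
  set D := ∫ X : Fin N → E3, ∑ j : Fin N, ∑ k : Fin 3,
    ‖fderiv ℝ ψ X (Pi.single j (EuclideanSpace.single k 1))‖ ^ 2
  set M := ∫ X : Fin N → E3, ‖ψ X‖ ^ 2
  have hD : 0 ≤ D := integral_nonneg fun X => by positivity
  have hM : 0 ≤ M := integral_nonneg fun X => by positivity
  have hgrad (i : Fin N) : Integrable (gradSq ψ i) :=
    integrable_finsetSum _ fun k _ => integrable_norm_sq_fderiv hψ hc _
  have hgradD (i : Fin N) : ∫ X, gradSq ψ i X ≤ D :=
    integral_mono (hgrad i) (integrable_finsetSum _ fun i _ => hgrad i) fun X =>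
      Finset.single_le_sum (f := fun i => gradSq ψ i X)
        (fun i _ => by unfold gradSq; positivity) (Finset.mem_univ i)
  have hB : 0 ≤ δ * D + δ⁻¹ * M := by positivity
  have hpair : ∀ p ∈ Finset.univ.filter (fun p : Fin N × Fin N => p.1 < p.2),
      ∫ X : Fin N → E3, ‖ψ X‖ ^ 2 / dist (X p.1) (X p.2) ≤ δ * D + δ⁻¹ * M := by
    intro p hp
    have h := integral_norm_sq_div_dist_le hψ hc hδ (Finset.mem_filter.1 hp).2.ne
    have h' := mul_le_mul_of_nonneg_left (hgradD p.1) hδ.le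
    linarith
  have hcard : ((Finset.univ.filter fun p : Fin N × Fin N => p.1 < p.2).card : ℝ) ≤ N ^ 2 := by
    have h := Finset.card_filter_le Finset.univ fun p : Fin N × Fin N => p.1 < p.2
    simp only [Finset.card_univ, Fintype.card_prod, Fintype.card_fin, ← sq] at h
    exact_mod_cast h
  calc _ ≤ _ := Finset.sum_le_card_nsmul _ _ _ hpair
    _ ≤ (N ^ 2 : ℝ) * (δ * D + δ⁻¹ * M) := by
      rw [nsmul_eq_mul]; gcongr
    _ = N ^ 2 * δ * D + N ^ 2 * δ⁻¹ * M := by ring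
    _ ≤ ε * D + N ^ 2 * δ⁻¹ * M := by
      gcongr
      have : (N ^ 2 + 1) * δ = ε := mul_div_cancel₀ _ (by positivity)
      linarith

end
end

section
/- Let N ∈ ℕ and let χ ∈ C_c^∞(ℝ³;ℝ) be nonnegative with ‖χ‖_{L²} = 1. With G(X,Y) := ∑_{π ∈ S_N} ∏_{i=1}^N χ(x_i − y_{π(i)}) and P(X) := ∫_{ℝ^{3N}} G(X,Y)² dY, one has P(X) ≥ N! for every X ∈ ℝ^{3N}. -/
open MeasureTheory Finset

noncomputable section

/-- A product over `i` of functions of `Y (π i)`, reindexed along the permutation `π`. -/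
theorem prod_comp_perm_eq_prod_symm {ι : Type*} [Fintype ι] (χ : E3 → ℝ) (X Y : ι → E3)
    (π : Equiv.Perm ι) :
    ∏ i, χ (X i - Y (π i)) = ∏ j, χ (X (π.symm j) - Y j) := by
  simpa using Equiv.prod_comp π fun j => χ (X (π.symm j) - Y j)

theorem integrable_prod_mul_prod {ι : Type*} [Fintype ι] {χ : E3 → ℝ} (hχ : Continuous χ)
    (hχc : HasCompactSupport χ) (X : ι → E3) (π σ : Equiv.Perm ι) :
    Integrable fun Y : ι → E3 =>
      (∏ i, χ (X i - Y (π i))) * ∏ i, χ (X i - Y (σ i)) := by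
  simp_rw [prod_comp_perm_eq_prod_symm, ← prod_mul_distrib]
  refine Integrable.fintype_prod
    (f := fun j y => χ (X (π.symm j) - y) * χ (X (σ.symm j) - y)) fun j => ?_
  refine Continuous.integrable_of_hasCompactSupport (by fun_prop) ?_
  exact (hχc.comp_homeomorph (Homeomorph.subLeft (X (π.symm j)))).mul_right

theorem integral_prod_sq {ι : Type*} [Fintype ι] {χ : E3 → ℝ}
    (hχ1 : (∫ x : E3, χ x ^ 2) = 1) (X : ι → E3) (π : Equiv.Perm ι) :
    ∫ Y : ι → E3, (∏ i, χ (X i - Y (π i))) ^ 2 = 1 := by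
  simp_rw [prod_comp_perm_eq_prod_symm, ← prod_pow]
  rw [integral_fintype_prod_volume_eq_prod fun j y => χ (X (π.symm j) - y) ^ 2]
  refine prod_eq_one fun j _ => ?_
  rw [integral_sub_left_eq_self (fun y => χ y ^ 2), hχ1]

/-- with `G(X,Y) = ∑_π ∏_i χ(x_i − y_{π(i)})` for a nonnegative
`χ ∈ C_c^∞(ℝ³)` with `‖χ‖_{L²} = 1`, one has `P(X) = ∫ G(X,Y)² dY ≥ N!`. -/
theorem integral_G_sq_ge_factorial
    (N : ℕ) (χ : E3 → ℝ) (hχ : ContDiff ℝ (⊤ : ℕ∞) χ) (hχc : HasCompactSupport χ)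
    (hχ0 : ∀ x, 0 ≤ χ x) (hχ1 : (∫ x : E3, χ x ^ 2) = 1) (X : Fin N → E3) :
    (N.factorial : ℝ) ≤
      ∫ Y : Fin N → E3,
        (∑ π : Equiv.Perm (Fin N), ∏ i : Fin N, χ (X i - Y (π i))) ^ 2 := by
  have hint : ∀ π σ : Equiv.Perm (Fin N), Integrable fun Y : Fin N → E3 =>
      (∏ i, χ (X i - Y (π i))) * ∏ i, χ (X i - Y (σ i)) :=
    integrable_prod_mul_prod hχ.continuous hχc X
  calc (N.factorial : ℝ)
      = ∑ π : Equiv.Perm (Fin N), ∫ Y : Fin N → E3, (∏ i, χ (X i - Y (π i))) ^ 2 := by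
        simp [integral_prod_sq hχ1, Fintype.card_perm]
    _ = ∫ Y : Fin N → E3, ∑ π : Equiv.Perm (Fin N), (∏ i, χ (X i - Y (π i))) ^ 2 :=
        (integral_finsetSum _ fun π _ => by simpa only [sq] using hint π π).symm
    _ ≤ _ := by
        refine integral_mono (integrable_finsetSum _ fun π _ => by simpa only [sq] using hint π π)
          ?_ fun Y => sum_sq_le_sq_sum_of_nonneg fun π _ => prod_nonneg fun i _ => hχ0 _
        simp_rw [sq, sum_mul_sum]
        exact integrable_finsetSum _ fun π _ => integrable_finsetSum _ fun σ _ => hint π σ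

end
end

section
/- Let N ∈ ℕ and let χ ∈ C_c^∞(ℝ³;ℝ) be nonnegative with ‖χ‖_{L²} = 1. Define G(X,Y) := ∑_{π ∈ S_N} ∏_{i=1}^N χ(x_i − y_{π(i)}), P(X) := ∫_{ℝ^{3N}} G(X,Y)² dY (so P(X) ≥ N! > 0), and for 1 ≤ j ≤ N set F_j(X) := ∫_{ℝ^{3N}} |∇_{x_j}( G(·,Y) P(·)^{−1/2} )(X)|² dY. Then for all X ∈ ℝ^{3N}: F_j(X) ≤ N ∫_{ℝ³} |∇χ(x)|² dx. -/
open MeasureTheory Finset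

noncomputable section

/-- `G(X,Y) = ∑_π ∏_i χ(x_i − y_{π(i)})`. -/
def locG (N : ℕ) (χ : E3 → ℝ) (X Y : Fin N → E3) : ℝ :=
  ∑ π : Equiv.Perm (Fin N), ∏ i : Fin N, χ (X i - Y (π i))

/-- `P(X) = ∫ G(X,Y)² dY`. -/
def locP (N : ℕ) (χ : E3 → ℝ) (X : Fin N → E3) : ℝ :=
  ∫ Y : Fin N → E3, locG N χ X Y ^ 2

/-- `F_j(X) = ∫ |∇_{x_j}(G(·,Y)P(·)^(−1/2))(X)|² dY`. -/
def locF (N : ℕ) (χ : E3 → ℝ) (j : Fin N) (X : Fin N → E3) : ℝ :=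
  ∫ Y : Fin N → E3, ∑ k : Fin 3,
    (fderiv ℝ (fun X' => locG N χ X' Y * locP N χ X' ^ (-(1 / 2) : ℝ)) X
        (Pi.single j (EuclideanSpace.single k 1))) ^ 2
theorem continuous_fderiv_param {H A : Type*} [NormedAddCommGroup H] [NormedSpace ℝ H]
    [NormedAddCommGroup A] [NormedSpace ℝ A] {F : H → A → ℝ}
    (hF : ContDiff ℝ 1 (fun p : H × A => F p.1 p.2)) :
    Continuous (fun p : H × A => fderiv ℝ (F · p.2) p.1) := by
  have h : ContDiff ℝ 1 (Function.uncurry fun (p : H × A) (x : H) => F x p.2) :=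
    hF.comp (contDiff_snd.prodMk (contDiff_snd.comp contDiff_fst))
  exact (ContDiff.fderiv (n := 0) (m := 1) h contDiff_fst (by simp)).continuous

/-- Differentiation under the integral sign for a `C¹` integrand whose support in the integration
variable is contained in a fixed compact set for all parameters near `x₀`. -/
theorem hasFDerivAt_integral_of_contDiff_of_isCompact {H A : Type*}
    [NormedAddCommGroup H] [NormedSpace ℝ H] [ProperSpace H]
    [NormedAddCommGroup A] [NormedSpace ℝ A] [SecondCountableTopology A]
    [MeasurableSpace A] [BorelSpace A] {μ : Measure A} [IsFiniteMeasureOnCompacts μ]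
    {F : H → A → ℝ} (hF : ContDiff ℝ 1 (fun p : H × A => F p.1 p.2)) {x₀ : H} {r : ℝ}
    (hr : 0 < r) {K : Set A} (hK : IsCompact K)
    (hFK : ∀ x ∈ Metric.ball x₀ r, ∀ a ∉ K, F x a = 0) :
    Integrable (fun a => fderiv ℝ (F · a) x₀) μ ∧
      HasFDerivAt (fun x => ∫ a, F x a ∂μ) (∫ a, fderiv ℝ (F · a) x₀ ∂μ) x₀ := by
  have hcont : ∀ x, Continuous (F x) := fun x =>
    hF.continuous.comp (Continuous.prodMk_right x)
  have hdiff : ∀ a, Differentiable ℝ (F · a) := fun a =>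
    (hF.comp (contDiff_id.prodMk contDiff_const)).differentiable one_ne_zero
  have hder := continuous_fderiv_param hF
  have hder₀ : Continuous fun a => fderiv ℝ (F · a) x₀ := hder.comp (Continuous.prodMk_right x₀)
  have hzero : ∀ a ∉ K, ∀ x ∈ Metric.ball x₀ r, fderiv ℝ (F · a) x = 0 := fun a ha x hx => by
    have h : (F · a) =ᶠ[nhds x] fun _ => 0 :=
      Filter.eventually_of_mem (Metric.isOpen_ball.mem_nhds hx) fun y hy => hFK y hy a ha
    simp [h.fderiv_eq]
  refine ⟨hder₀.integrable_of_hasCompactSupport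
    (HasCompactSupport.intro hK fun a ha => hzero a ha x₀ (Metric.mem_ball_self hr)), ?_⟩
  obtain ⟨C, hC⟩ := ((isCompact_closedBall x₀ r).prod hK).exists_bound_of_continuousOn
    hder.continuousOn
  refine hasFDerivAt_integral_of_dominated_of_fderiv_le (s := Metric.ball x₀ r)
    (bound := K.indicator fun _ => C) (F' := fun x a => fderiv ℝ (F · a) x)
    (Metric.ball_mem_nhds x₀ hr)
    (Filter.Eventually.of_forall fun x => (hcont x).aestronglyMeasurable) ?_
    hder₀.aestronglyMeasurable ?_ ?_ ?_
  · exact (hcont x₀).integrable_of_hasCompactSupport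
      (HasCompactSupport.intro hK (hFK x₀ (Metric.mem_ball_self hr)))
  · refine Filter.Eventually.of_forall fun a x hx => ?_
    by_cases ha : a ∈ K
    · simpa [ha] using hC (x, a) ⟨Metric.ball_subset_closedBall hx, ha⟩
    · simp [ha, hzero a ha x hx]
  · exact (integrable_indicator_iff hK.measurableSet).2
      (integrableOn_const hK.measure_lt_top.ne)
  · exact Filter.Eventually.of_forall fun a x _ => (hdiff a x).hasFDerivAt

/-- Fubini for a function of one coordinate times a function independent of that coordinate. -/
theorem integral_coord_mul {n : ℕ} (k : Fin (n + 1)) (f : E3 → ℝ)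
    (g : (Fin (n + 1) → E3) → ℝ) (hg : ∀ Y a, g (Function.update Y k a) = g Y) :
    ∫ Y, f (Y k) * g Y = (∫ x, f x) * ∫ Y, g (k.insertNth 0 Y) := by
  have h := (volume_preserving_piFinSuccAbove (fun _ : Fin (n + 1) => E3) k).symm
  rw [← h.integral_comp', ← integral_prod_mul, Measure.volume_eq_prod]
  refine integral_congr_ae (Filter.Eventually.of_forall fun p => ?_)
  have hp : g (k.insertNth p.1 p.2) = g (k.insertNth 0 p.2) := by
    rw [← hg (k.insertNth 0 p.2) p.1, Fin.update_insertNth]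
  simp [MeasurableEquiv.piFinSuccAbove_symm_apply, Fin.insertNthEquiv, hp]

/-- The permanent of `χ(x_i − y_l)` with row `j` and column `k` removed. -/
def locMinor (N : ℕ) (χ : E3 → ℝ) (X : Fin N → E3) (j k : Fin N) (Y : Fin N → E3) : ℝ :=
  ∑ π : Equiv.Perm (Fin N) with π j = k, ∏ i ∈ univ.erase j, χ (X i - Y (π i))

section

variable {N : ℕ} {χ : E3 → ℝ}

theorem locG_update (X Y : Fin N → E3) (j : Fin N) (z : E3) :
    locG N χ (Function.update X j z) Y = ∑ k, χ (z - Y k) * locMinor N χ X j k Y := by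
  simp only [locG, locMinor, mul_sum]
  rw [← sum_fiberwise univ (fun π : Equiv.Perm (Fin N) => π j)]
  refine sum_congr rfl fun k _ => sum_congr rfl fun π hπ => ?_
  rw [← mul_prod_erase univ _ (mem_univ j), (mem_filter.1 hπ).2, Function.update_self]
  congr 1
  refine prod_congr rfl fun i hi => ?_
  rw [Function.update_of_ne (ne_of_mem_erase hi)]

theorem locG_eq_sum_locMinor (X Y : Fin N → E3) (j : Fin N) :
    locG N χ X Y = ∑ k, χ (X j - Y k) * locMinor N χ X j k Y := by
  rw [← locG_update, Function.update_eq_self]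

theorem locMinor_update (X : Fin N → E3) (j k : Fin N) (Y : Fin N → E3) (a : E3) :
    locMinor N χ X j k (Function.update Y k a) = locMinor N χ X j k Y := by
  refine sum_congr rfl fun π hπ => prod_congr rfl fun i hi => ?_
  rw [Function.update_of_ne]
  rw [← (mem_filter.1 hπ).2]
  exact fun h => ne_of_mem_erase hi (π.injective h)

theorem locMinor_nonneg (hχ0 : ∀ x, 0 ≤ χ x) (X : Fin N → E3) (j k : Fin N)
    (Y : Fin N → E3) : 0 ≤ locMinor N χ X j k Y :=
  sum_nonneg fun _ _ => prod_nonneg fun _ _ => hχ0 _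

theorem continuous_locMinor (hχ : Continuous χ) (X : Fin N → E3) (j k : Fin N) :
    Continuous (locMinor N χ X j k) := by
  unfold locMinor
  fun_prop

theorem contDiff_locG {n : WithTop ℕ∞} (hχ : ContDiff ℝ n χ) :
    ContDiff ℝ n (fun p : (Fin N → E3) × (Fin N → E3) => locG N χ p.1 p.2) := by
  unfold locG
  refine ContDiff.sum fun π _ => contDiff_prod fun i _ => hχ.comp ?_
  exact ((contDiff_apply ℝ E3 i).comp contDiff_fst).sub
    ((contDiff_apply ℝ E3 (π i)).comp contDiff_snd)

theorem differentiable_locG (hχ : ContDiff ℝ 1 χ) (Y : Fin N → E3) :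
    Differentiable ℝ (fun X => locG N χ X Y) :=
  ((contDiff_locG hχ).comp (contDiff_id.prodMk contDiff_const)).differentiable one_ne_zero

theorem norm_le_of_forall_perm {R : ℝ} (hR : 0 ≤ R) {X Y : Fin N → E3}
    (π : Equiv.Perm (Fin N)) (h : ∀ i, ‖X i - Y (π i)‖ ≤ R) : ‖Y‖ ≤ ‖X‖ + R := by
  refine (pi_norm_le_iff_of_nonneg (by positivity)).2 fun l => ?_
  have h1 := h (π.symm l)
  rw [Equiv.apply_symm_apply] at h1
  have h2 := norm_le_pi_norm X (π.symm l)
  have h3 := norm_sub_norm_le (Y l) (X (π.symm l))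
  rw [norm_sub_rev] at h3
  linarith

theorem mul_locMinor_eq_zero {R : ℝ} (hR : 0 ≤ R) (hχR : ∀ x, R < ‖x‖ → χ x = 0)
    {f : E3 → ℝ} (hf : ∀ x, R < ‖x‖ → f x = 0) {X Y : Fin N → E3} (j k : Fin N)
    (hY : ‖X‖ + R < ‖Y‖) : f (X j - Y k) * locMinor N χ X j k Y = 0 := by
  by_contra h
  obtain ⟨h1, h2⟩ := mul_ne_zero_iff.1 h
  obtain ⟨π, hπ, h3⟩ := exists_ne_zero_of_sum_ne_zero h2
  refine hY.not_ge (norm_le_of_forall_perm hR π fun i => ?_)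
  by_contra! hi
  by_cases hij : i = j
  · subst hij
    rw [(mem_filter.1 hπ).2] at hi
    exact h1 (hf _ hi)
  · exact prod_ne_zero_iff.1 h3 i (mem_erase.2 ⟨hij, mem_univ i⟩) (hχR _ hi)

theorem locG_eq_zero {R : ℝ} (hR : 0 ≤ R) (hχR : ∀ x, R < ‖x‖ → χ x = 0)
    {X Y : Fin N → E3} (hY : ‖X‖ + R < ‖Y‖) : locG N χ X Y = 0 := by
  by_contra h
  obtain ⟨π, -, h3⟩ := exists_ne_zero_of_sum_ne_zero h
  refine hY.not_ge (norm_le_of_forall_perm hR π fun i => ?_)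
  by_contra! hi
  exact prod_ne_zero_iff.1 h3 i (mem_univ i) (hχR _ hi)

theorem fderiv_locG_single (hχ : ContDiff ℝ 1 χ) (X Y : Fin N → E3) (j : Fin N) (e : E3) :
    fderiv ℝ (fun X' => locG N χ X' Y) X (Pi.single j e) =
      ∑ k, fderiv ℝ χ (X j - Y k) e * locMinor N χ X j k Y := by
  have hd := differentiable_locG hχ Y
  have h1 : HasFDerivAt (fun z => locG N χ (Function.update X j z) Y)
      ((fderiv ℝ (fun X' => locG N χ X' Y) X).comp
        (ContinuousLinearMap.pi (Pi.single j (ContinuousLinearMap.id ℝ E3)))) (X j) := by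
    refine HasFDerivAt.comp (g := fun X' => locG N χ X' Y) (X j) ?_ (hasFDerivAt_update X (X j))
    rw [Function.update_eq_self]
    exact (hd X).hasFDerivAt
  have h2 : HasFDerivAt (fun z => locG N χ (Function.update X j z) Y)
      (∑ k, locMinor N χ X j k Y • fderiv ℝ χ (X j - Y k)) (X j) := by
    simp only [locG_update]
    refine HasFDerivAt.fun_sum fun k _ => HasFDerivAt.mul_const ?_ _
    exact (hasFDerivAt_comp_sub (f := χ) (x := X j) (Y k)).2
      (hχ.differentiable one_ne_zero _).hasFDerivAt
  have h3 := congrArg (fun L : E3 →L[ℝ] ℝ => L e) (h1.unique h2)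
  have h4 : (ContinuousLinearMap.pi (Pi.single j (ContinuousLinearMap.id ℝ E3)) :
      E3 →L[ℝ] (Fin N → E3)) e = Pi.single j e := by
    ext1 i
    by_cases hij : i = j
    · subst hij; simp
    · simp [hij]
  simpa [h4, mul_comm, _root_.sum_apply] using h3

theorem integral_sq_mul_locMinor {n : ℕ} (f : E3 → ℝ) (X : Fin (n + 1) → E3)
    (j k : Fin (n + 1)) :
    ∫ Y, (f (X j - Y k) * locMinor (n + 1) χ X j k Y) ^ 2 =
      (∫ x, f x ^ 2) * ∫ Y, locMinor (n + 1) χ X j k (k.insertNth 0 Y) ^ 2 := by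
  simp only [mul_pow]
  rw [integral_coord_mul k (fun y => f (X j - y) ^ 2) (fun Y => locMinor (n + 1) χ X j k Y ^ 2)
    fun Y a => by rw [locMinor_update], integral_sub_left_eq_self (fun y => f y ^ 2)]

theorem integrable_sq_mul_locMinor {R : ℝ} (hR : 0 ≤ R) (hχR : ∀ x, R < ‖x‖ → χ x = 0)
    (hχ : Continuous χ) {f : E3 → ℝ} (hfc : Continuous f) (hf : ∀ x, R < ‖x‖ → f x = 0)
    (X : Fin N → E3) (j k : Fin N) :
    Integrable fun Y => (f (X j - Y k) * locMinor N χ X j k Y) ^ 2 := by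
  have := continuous_locMinor hχ X j k
  refine Continuous.integrable_of_hasCompactSupport (by fun_prop)
    (HasCompactSupport.intro (isCompact_closedBall 0 (‖X‖ + R)) fun Y hY => ?_)
  rw [mul_locMinor_eq_zero hR hχR hf j k (by simpa using hY)]
  simp

/-- The `L²` norm of a directional derivative of `G` is controlled by `P`. -/
theorem integral_sq_sum_le {R : ℝ} (hR : 0 ≤ R) (hχR : ∀ x, R < ‖x‖ → χ x = 0)
    (hχ : Continuous χ) (hχ0 : ∀ x, 0 ≤ χ x) (hχ1 : (∫ x : E3, χ x ^ 2) = 1)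
    {f : E3 → ℝ} (hfc : Continuous f) (hf : ∀ x, R < ‖x‖ → f x = 0)
    (X : Fin N → E3) (j : Fin N) (hG : Integrable fun Y => locG N χ X Y ^ 2) :
    ∫ Y, (∑ k, f (X j - Y k) * locMinor N χ X j k Y) ^ 2 ≤
      N * (∫ x, f x ^ 2) * locP N χ X := by
  obtain _ | n := N
  · exact j.elim0
  have hintf := integrable_sq_mul_locMinor hR hχR hχ hfc hf X j
  have hintχ := integrable_sq_mul_locMinor hR hχR hχ hχ hχR X j
  calc ∫ Y, (∑ k, f (X j - Y k) * locMinor (n + 1) χ X j k Y) ^ 2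
      ≤ ∫ Y, ((n + 1 : ℕ) : ℝ) * ∑ k, (f (X j - Y k) * locMinor (n + 1) χ X j k Y) ^ 2 := by
        refine integral_mono_of_nonneg (Filter.Eventually.of_forall fun Y => sq_nonneg _)
          ((integrable_finsetSum _ fun k _ => hintf k).const_mul _)
          (Filter.Eventually.of_forall fun Y => ?_)
        simpa using sq_sum_le_card_mul_sum_sq (s := univ)
          (f := fun k => f (X j - Y k) * locMinor (n + 1) χ X j k Y)
    _ = ((n + 1 : ℕ) : ℝ) * (∫ x, f x ^ 2) *
          ∑ k, ∫ Y, (χ (X j - Y k) * locMinor (n + 1) χ X j k Y) ^ 2 := by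
        rw [integral_const_mul, integral_finsetSum _ fun k _ => hintf k]
        simp only [integral_sq_mul_locMinor, hχ1, one_mul, ← mul_sum, mul_assoc]
    _ ≤ ((n + 1 : ℕ) : ℝ) * (∫ x, f x ^ 2) * locP (n + 1) χ X := by
        refine mul_le_mul_of_nonneg_left ?_
          (mul_nonneg (Nat.cast_nonneg _) (integral_nonneg fun _ => sq_nonneg _))
        rw [← integral_finsetSum _ fun k _ => hintχ k]
        refine integral_mono (integrable_finsetSum _ fun k _ => hintχ k) hG fun Y => ?_
        simp only [locG_eq_sum_locMinor X Y j]
        exact sum_sq_le_sq_sum_of_nonneg fun k _ =>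
          mul_nonneg (hχ0 _) (locMinor_nonneg hχ0 X j k Y)

theorem locP_pos (hχ : ContDiff ℝ 1 χ) (hχ0 : ∀ x, 0 ≤ χ x)
    (hχ1 : (∫ x : E3, χ x ^ 2) = 1) {X : Fin N → E3}
    (hsupp : HasCompactSupport fun Y => locG N χ X Y ^ 2) : 0 < locP N χ X := by
  have hz : ∃ z, χ z ≠ 0 := by
    by_contra! h
    simp [h] at hχ1
  obtain ⟨z, hz⟩ := hz
  refine Continuous.integral_pos_of_hasCompactSupport_nonneg_nonzero (x := fun i => X i - z)
    (((contDiff_locG hχ).continuous.comp (Continuous.prodMk_right X)).pow 2) hsupp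
    (fun Y => sq_nonneg _) (pow_ne_zero 2 (ne_of_gt ?_))
  refine sum_pos' (fun π _ => prod_nonneg fun i _ => hχ0 _) ⟨1, mem_univ _, prod_pos fun i _ => ?_⟩
  simpa using (hχ0 z).lt_of_ne' hz

theorem exists_hasFDerivAt_locP {R : ℝ} (hR : 0 ≤ R) (hχR : ∀ x, R < ‖x‖ → χ x = 0)
    (hχ : ContDiff ℝ 1 χ) (X : Fin N → E3) :
    ∃ L : (Fin N → E3) →L[ℝ] ℝ, HasFDerivAt (locP N χ) L X ∧
      ∀ v, L v = 2 * ∫ Y, locG N χ X Y * fderiv ℝ (fun X' => locG N χ X' Y) X v := by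
  obtain ⟨hi, hd⟩ := hasFDerivAt_integral_of_contDiff_of_isCompact
    (μ := (volume : Measure (Fin N → E3))) (F := fun X Y => locG N χ X Y ^ 2)
    (x₀ := X) ((contDiff_locG hχ).pow 2) one_pos (isCompact_closedBall 0 (‖X‖ + 1 + R))
    fun X' hX' Y hY => by
      have h1 : ‖X'‖ ≤ ‖X‖ + 1 := by
        have := norm_le_norm_add_norm_sub' X' X
        rw [mem_ball_iff_norm] at hX'
        linarith
      rw [mem_closedBall_zero_iff, not_le] at hY
      rw [locG_eq_zero hR hχR (by linarith)]
      simp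
  refine ⟨_, hd, fun v => ?_⟩
  rw [ContinuousLinearMap.integral_apply hi, ← integral_const_mul]
  refine integral_congr_ae (Filter.Eventually.of_forall fun Y => ?_)
  have hsq := ((differentiable_locG hχ Y X).hasFDerivAt.pow 2).fderiv
  simp only [hsq]
  simp [mul_assoc]

theorem fderiv_normalized {H : Type*} [NormedAddCommGroup H] [NormedSpace ℝ H] {g p : H → ℝ}
    {x : H} {L : H →L[ℝ] ℝ} (hg : DifferentiableAt ℝ g x) (hp : HasFDerivAt p L x)
    (hpx : 0 < p x) (v : H) :
    fderiv ℝ (fun y => g y * p y ^ (-(1 / 2) : ℝ)) x v =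
      p x ^ (-(1 / 2) : ℝ) * fderiv ℝ g x v
        + -(p x ^ (-(1 / 2) : ℝ) * (L v / 2) / p x) * g x := by
  have h := hg.hasFDerivAt.mul (hp.rpow_const (p := (-(1 / 2) : ℝ)) (Or.inl hpx.ne'))
  rw [show fderiv ℝ (fun y => g y * p y ^ (-(1 / 2) : ℝ)) x = _ from h.fderiv]
  simp only [_root_.add_apply, _root_.smul_apply, smul_eq_mul, Real.rpow_sub_one hpx.ne']
  ring

/-- If `b` is the coefficient making `s • h + b • g` orthogonal to `g`, then its squared `L²` norm
is at most `s²` times that of `h`. -/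
theorem integral_sq_normalized_le {A : Type*} [MeasurableSpace A] {μ : Measure A}
    {g h : A → ℝ} (hg : Integrable (fun a => g a ^ 2) μ) (hh : Integrable (fun a => h a ^ 2) μ)
    (hgh : Integrable (fun a => g a * h a) μ) {p : ℝ} (hp : 0 < p)
    (hgp : ∫ a, g a ^ 2 ∂μ = p) {s b : ℝ}
    (hb : b = -(s * (∫ a, g a * h a ∂μ) / p)) :
    Integrable (fun a => (s * h a + b * g a) ^ 2) μ ∧
      ∫ a, (s * h a + b * g a) ^ 2 ∂μ ≤ s ^ 2 * ∫ a, h a ^ 2 ∂μ := by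
  have e : (fun a => (s * h a + b * g a) ^ 2) =
      fun a => s ^ 2 * h a ^ 2 + 2 * s * b * (g a * h a) + b ^ 2 * g a ^ 2 := by
    ext a; ring
  have i1 := hh.const_mul (s ^ 2)
  have i2 := hgh.const_mul (2 * s * b)
  have i3 := hg.const_mul (b ^ 2)
  rw [e]
  refine ⟨(i1.add i2).add i3, ?_⟩
  rw [integral_add (f := fun a => s ^ 2 * h a ^ 2 + 2 * s * b * (g a * h a)) (i1.add i2) i3,
    integral_add i1 i2, integral_const_mul, integral_const_mul,
    integral_const_mul, hgp, hb]
  set q := ∫ a, g a * h a ∂μ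
  have : 2 * s * -(s * q / p) * q + (-(s * q / p)) ^ 2 * p = -((s * q) ^ 2 / p) := by
    field_simp; ring
  have : 0 ≤ (s * q) ^ 2 / p := by positivity
  linarith

end

theorem locF_le
    (N : ℕ) (χ : E3 → ℝ) (hχ : ContDiff ℝ (⊤ : ℕ∞) χ) (hχc : HasCompactSupport χ)
    (hχ0 : ∀ x, 0 ≤ χ x) (hχ1 : (∫ x : E3, χ x ^ 2) = 1)
    (j : Fin N) (X : Fin N → E3) :
    locF N χ j X ≤
      (N : ℝ) * ∫ x : E3, ∑ k : Fin 3, (fderiv ℝ χ x (EuclideanSpace.single k 1)) ^ 2 := by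
  have hχ' : ContDiff ℝ 1 χ := hχ.of_le (by exact_mod_cast le_top)
  obtain ⟨R, hR, hχR⟩ : ∃ R : ℝ, 0 ≤ R ∧ ∀ x, R < ‖x‖ → x ∉ tsupport χ := by
    obtain ⟨R, hR⟩ := hχc.isCompact.isBounded.subset_closedBall (0 : E3)
    refine ⟨max R 0, le_max_right _ _, fun x hx hx' => ?_⟩
    have := hR hx'
    rw [mem_closedBall_zero_iff] at this
    exact ((le_max_left R 0).trans_lt hx).not_ge this
  have hχz : ∀ x, R < ‖x‖ → χ x = 0 := fun x hx => image_eq_zero_of_notMem_tsupport (hχR x hx)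
  have hdz : ∀ e x, R < ‖x‖ → fderiv ℝ χ x e = 0 := fun e x hx => by
    rw [fderiv_of_notMem_tsupport ℝ (hχR x hx)]; rfl
  have hdc : ∀ e, Continuous fun x => fderiv ℝ χ x e := fun e =>
    (hχ'.continuous_fderiv one_ne_zero).clm_apply continuous_const
  have hGc : ∀ X, Continuous (locG N χ X) := fun X =>
    (contDiff_locG hχ').continuous.comp (Continuous.prodMk_right X)
  have hint : ∀ {g : (Fin N → E3) → ℝ}, Continuous g → (∀ Y, ‖X‖ + R < ‖Y‖ → g Y = 0) →
      Integrable g := fun hg h => hg.integrable_of_hasCompactSupport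
    (HasCompactSupport.intro (isCompact_closedBall 0 (‖X‖ + R)) fun Y hY => h Y (by simpa using hY))
  have hGz : ∀ Y, ‖X‖ + R < ‖Y‖ → locG N χ X Y = 0 := fun Y => locG_eq_zero hR hχz
  have hG2 : Integrable fun Y => locG N χ X Y ^ 2 :=
    hint ((hGc X).pow 2) fun Y hY => by simp [hGz Y hY]
  have hP : 0 < locP N χ X := locP_pos hχ' hχ0 hχ1
    (HasCompactSupport.intro (isCompact_closedBall 0 (‖X‖ + R)) fun Y hY => by
      simp [hGz Y (by simpa using hY)])
  set D : E3 → (Fin N → E3) → ℝ := fun e Y =>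
    ∑ k, fderiv ℝ χ (X j - Y k) e * locMinor N χ X j k Y with hD
  have hDc : ∀ e, Continuous (D e) := fun e => by
    refine continuous_finsetSum _ fun k _ => ?_
    exact ((hdc e).comp (by fun_prop)).mul (continuous_locMinor hχ'.continuous X j k)
  have hDz : ∀ e Y, ‖X‖ + R < ‖Y‖ → D e Y = 0 := fun e Y hY =>
    sum_eq_zero fun k _ => mul_locMinor_eq_zero hR hχz (hdz e) j k hY
  obtain ⟨L, hPd, hL⟩ := exists_hasFDerivAt_locP hR hχz hχ' X
  have hGD : ∀ e, Integrable fun Y => locG N χ X Y * D e Y := fun e =>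
    hint ((hGc X).mul (hDc e)) fun Y hY => by simp [hGz Y hY]
  have hD2 : ∀ e, Integrable fun Y => D e Y ^ 2 := fun e =>
    hint ((hDc e).pow 2) fun Y hY => by simp [hDz e Y hY]
  set s : ℝ := locP N χ X ^ (-(1 / 2) : ℝ) with hs
  have hs2 : s ^ 2 = (locP N χ X)⁻¹ := by
    rw [hs, ← Real.rpow_natCast, ← Real.rpow_mul hP.le, ← Real.rpow_neg_one]
    norm_num
  set b : E3 → ℝ := fun e => -(s * (∫ Y, locG N χ X Y * D e Y) / locP N χ X) with hb
  have hu : ∀ Y e, fderiv ℝ (fun X' => locG N χ X' Y * locP N χ X' ^ (-(1 / 2) : ℝ)) X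
      (Pi.single j e) = s * D e Y + b e * locG N χ X Y := fun Y e => by
    rw [fderiv_normalized (differentiable_locG hχ' Y X) hPd hP, hL,
      mul_div_cancel_left₀ _ two_ne_zero]
    simp only [fderiv_locG_single hχ', hb, hD, hs]
  have hmain := fun e =>
    integral_sq_normalized_le hG2 (hD2 e) (hGD e) hP rfl (s := s) (b := b e) rfl
  have hdi : ∀ e, Integrable fun x => fderiv ℝ χ x e ^ 2 := fun e =>
    ((hdc e).pow 2).integrable_of_hasCompactSupport
      (HasCompactSupport.intro (isCompact_closedBall 0 R) fun x hx => by
        simp [hdz e x (by simpa using hx)])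
  unfold locF
  simp only [hu]
  rw [integral_finsetSum _ fun k _ => (hmain _).1, integral_finsetSum _ fun k _ => hdi _, mul_sum]
  refine sum_le_sum fun k _ => (hmain _).2.trans ?_
  rw [hs2, inv_mul_le_iff₀ hP, mul_comm (locP N χ X)]
  exact integral_sq_sum_le hR hχz hχ'.continuous hχ0 hχ1 (hdc _) (hdz _) X j hG2
end
end

section
/- Let R > 0, N ∈ ℕ, and y₁,…,y_N ∈ ℝ³. Then there exist m ∈ ℕ with m ≤ N, positive integers n₁,…,n_m with ∑_{i=1}^m n_i = N, closed balls B₁,…,B_m ⊆ ℝ³ where B_i has radius R_i = (3n_i − 1)R/2, and a partition of {1,…,N} into sets C₁,…,C_m with |C_i| = n_i, such that: (i) dist(B_i, B_j) ≥ R for all i ≠ j, and (ii) the ball of radius R centered at y_k is contained in B_i for every k ∈ C_i. -/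
open Metric Finset

noncomputable section

/-- If two closed balls of radii `(3a-1)R/2` and `(3b-1)R/2` contain points at distance less
than `R`, then some closed ball of radius `(3(a+b)-1)R/2` contains both of them. -/
theorem exists_closedBall_superset_of_dist_lt {E : Type*} [NormedAddCommGroup E]
    [NormedSpace ℝ E] {R a b : ℝ} (ha : 0 < a) (hb : 0 < b) {p q u v : E}
    (hu : u ∈ closedBall p ((3 * a - 1) * R / 2)) (hv : v ∈ closedBall q ((3 * b - 1) * R / 2))
    (huv : dist u v < R) :
    ∃ z, closedBall p ((3 * a - 1) * R / 2) ⊆ closedBall z ((3 * (a + b) - 1) * R / 2) ∧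
      closedBall q ((3 * b - 1) * R / 2) ⊆ closedBall z ((3 * (a + b) - 1) * R / 2) := by
  have hpq : dist p q ≤ 3 * (a + b) * R / 2 := by
    have := dist_triangle4 p u v q
    rw [mem_closedBall, dist_comm] at hu
    rw [mem_closedBall] at hv
    linarith
  have hab : 0 < a + b := add_pos ha hb
  have hscale : ∀ t, 0 < t → t / (a + b) * dist p q ≤ 3 * t * R / 2 := fun t ht => by
    rw [div_mul_eq_mul_div, div_le_iff₀ hab]
    nlinarith [mul_le_mul_of_nonneg_left hpq ht.le]
  refine ⟨AffineMap.lineMap p q (b / (a + b)), closedBall_subset_closedBall' ?_,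
    closedBall_subset_closedBall' ?_⟩
  · rw [dist_left_lineMap, Real.norm_of_nonneg (by positivity)]
    linarith [hscale b hb]
  · have h1 : 1 - b / (a + b) = a / (a + b) := by field_simp; ring
    rw [dist_right_lineMap, h1, Real.norm_of_nonneg (by positivity)]
    linarith [hscale a ha]

/-- The colour class of `i` under the colouring `f`. -/
def colorClass {ι : Type*} [Fintype ι] [DecidableEq ι] (f : ι → ι) (i : ι) : Finset ι :=
  univ.filter fun k => f k = i

theorem mem_colorClass {ι : Type*} [Fintype ι] [DecidableEq ι] {f : ι → ι} {i k : ι} :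
    k ∈ colorClass f i ↔ f k = i := by
  simp [colorClass]

/-- Any colouring of the points whose classes lie in balls of the prescribed radii can be
coarsened to one for which these balls are pairwise at distance at least `R`. -/
theorem exists_separated_coloring {E ι : Type*} [NormedAddCommGroup E] [NormedSpace ℝ E]
    [Fintype ι] [DecidableEq ι] (R : ℝ) (y : ι → E) (f : ι → ι) (c : ι → E)
    (hf : ∀ k, closedBall (y k) R ⊆
      closedBall (c (f k)) ((3 * (#(colorClass f (f k)) : ℝ) - 1) * R / 2)) :
    ∃ (g : ι → ι) (d : ι → E),
      (∀ k, closedBall (y k) R ⊆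
        closedBall (d (g k)) ((3 * (#(colorClass g (g k)) : ℝ) - 1) * R / 2)) ∧
      ∀ i ∈ univ.image g, ∀ j ∈ univ.image g, i ≠ j →
        ∀ u ∈ closedBall (d i) ((3 * (#(colorClass g i) : ℝ) - 1) * R / 2),
          ∀ v ∈ closedBall (d j) ((3 * (#(colorClass g j) : ℝ) - 1) * R / 2), R ≤ dist u v := by
  induction hn : #(univ.image f) using Nat.strong_induction_on generalizing f c with
  | _ n ih =>
  by_cases hsep : ∀ i ∈ univ.image f, ∀ j ∈ univ.image f, i ≠ j →
      ∀ u ∈ closedBall (c i) ((3 * (#(colorClass f i) : ℝ) - 1) * R / 2),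
        ∀ v ∈ closedBall (c j) ((3 * (#(colorClass f j) : ℝ) - 1) * R / 2), R ≤ dist u v
  · exact ⟨f, c, hf, hsep⟩
  push Not at hsep
  obtain ⟨i, hi, j, hj, hij, u, hu, v, hv, huv⟩ := hsep
  have hpos : ∀ l ∈ univ.image f, (0 : ℝ) < #(colorClass f l) := fun l hl => by
    obtain ⟨k, -, hk⟩ := mem_image.1 hl
    exact_mod_cast card_pos.2 ⟨k, mem_colorClass.2 hk⟩
  obtain ⟨z, hzi, hzj⟩ :=
    exists_closedBall_superset_of_dist_lt (hpos i hi) (hpos j hj) hu hv huv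
  let g : ι → ι := fun k => if f k = j then i else f k
  have hgi : colorClass g i = colorClass f i ∪ colorClass f j := by
    ext k
    simp only [mem_union, mem_colorClass, g]
    split_ifs <;> simp_all
  have hcard : (#(colorClass g i) : ℝ) = #(colorClass f i) + #(colorClass f j) := by
    rw [hgi, card_union_of_disjoint, Nat.cast_add]
    exact disjoint_left.2 fun k hk hk' =>
      hij ((mem_colorClass.1 hk).symm.trans (mem_colorClass.1 hk'))
  have hgl : ∀ l, l ≠ i → l ≠ j → colorClass g l = colorClass f l := fun l hli hlj => by
    ext k
    simp only [mem_colorClass, g]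
    split_ifs with h
    · simp [h, hli.symm, hlj.symm]
    · rfl
  have himage : univ.image g ⊂ univ.image f := by
    refine (ssubset_iff_of_subset fun l hl => ?_).2 ⟨j, hj, fun hl => ?_⟩
    · obtain ⟨k, -, rfl⟩ := mem_image.1 hl
      simp only [g]
      split_ifs
      · exact hi
      · exact mem_image_of_mem f (mem_univ k)
    · obtain ⟨k, -, hk⟩ := mem_image.1 hl
      simp only [g] at hk
      split_ifs at hk with h
      · exact hij hk
      · exact h hk
  refine ih _ (hn ▸ card_lt_card himage) g (Function.update c i z) (fun k => ?_) rfl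
  by_cases hkj : f k = j
  · have hk : g k = i := by simp [g, hkj]
    rw [hk, hcard, Function.update_self]
    exact (hkj ▸ hf k).trans hzj
  have hk : g k = f k := by simp [g, hkj]
  rw [hk]
  by_cases hki : f k = i
  · rw [hki, hcard, Function.update_self]
    exact (hki ▸ hf k).trans hzi
  · rw [hgl _ hki hkj, Function.update_of_ne hki]
    exact hf k

/-- ball clustering. Given `R > 0` and points `y₁,…,y_N ∈ ℝ³`, there are
`m ≤ N` balls `B_i` of radius `(3n_i−1)R/2` that are pairwise at distance `≥ R`, and a
partition `C₁,…,C_m` of `{1,…,N}` with `|C_i| = n_i` such that the ball of radius `R`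
around `y_k` is contained in `B_i` for every `k ∈ C_i`. -/
theorem ball_clustering (R : ℝ) (hR : 0 < R) (N : ℕ) (y : Fin N → E3) :
    ∃ (m : ℕ) (_ : m ≤ N) (n : Fin m → ℕ) (c : Fin m → E3) (C : Fin m → Finset (Fin N)),
      (∀ i, 0 < n i) ∧
      (∑ i, n i) = N ∧
      (∀ i j, i ≠ j →
        ∀ u ∈ closedBall (c i) ((3 * (n i : ℝ) - 1) * R / 2),
          ∀ v ∈ closedBall (c j) ((3 * (n j : ℝ) - 1) * R / 2), R ≤ dist u v) ∧
      (∀ k : Fin N, ∃! i, k ∈ C i) ∧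
      (∀ i, (C i).card = n i) ∧
      (∀ i, ∀ k ∈ C i,
        closedBall (y k) R ⊆ closedBall (c i) ((3 * (n i : ℝ) - 1) * R / 2)) := by
  obtain ⟨g, d, hg, hsep⟩ := exists_separated_coloring R y id y fun k => by
    have h : colorClass id k = {k} := by ext; simp [mem_colorClass]
    refine closedBall_subset_closedBall ?_
    simp only [id_eq, h, card_singleton, Nat.cast_one]
    linarith
  let e := (univ.image g).equivFin.symm
  refine ⟨#(univ.image g), card_image_le.trans_eq (card_fin N), fun i => #(colorClass g (e i)),
    fun i => d (e i), fun i => colorClass g (e i), fun i => ?_, ?_, fun i j hij => ?_,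
    fun k => ?_, fun _ => rfl, fun i k hk => ?_⟩
  · obtain ⟨k, -, hk⟩ := mem_image.1 (e i).2
    exact card_pos.2 ⟨k, mem_colorClass.2 hk⟩
  · rw [e.sum_comp fun x => #(colorClass g x), sum_coe_sort _ fun x => #(colorClass g x)]
    exact (card_eq_sum_card_image g univ).symm.trans (card_fin N)
  · exact hsep _ (e i).2 _ (e j).2 fun h => hij (e.injective (Subtype.ext h))
  · refine ⟨e.symm ⟨g k, mem_image_of_mem g (mem_univ k)⟩, by simp [mem_colorClass],
      fun i hi => e.injective (Subtype.ext ?_)⟩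
    simpa using (mem_colorClass.1 hi).symm
  · simpa only [mem_colorClass.1 hk] using hg k

end
end

section
/- (KLMN theorem for quadratic forms.) Let H be a complex Hilbert space, D ⊆ H a dense subspace, and q : D × D → ℂ a sesquilinear form with q(φ,φ) ≥ 0 for all φ ∈ D which is closable, in the sense: for every sequence (φ_n) in D with ‖φ_n‖ → 0 and q(φ_n − φ_m, φ_n − φ_m) → 0 as n,m → ∞, one has q(φ_n,φ_n) → 0. Let β : D × D → ℂ be a symmetric sesquilinear form and suppose there are 0 ≤ a < 1 and b ∈ ℝ such that |β(φ,φ)| ≤ a·q(φ,φ) + b‖φ‖² for all φ ∈ D. Then the form γ := q + β satisfies γ(φ,φ) ≥ −b‖φ‖² for all φ ∈ D, and γ is closable in the corresponding sense: for every sequence (φ_n) in D with ‖φ_n‖ → 0 and (γ + b‖·‖²)(φ_n − φ_m, φ_n − φ_m) → 0 as n,m → ∞, one has γ(φ_n,φ_n) → 0. -/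
open Filter

noncomputable section

/-- KLMN theorem for quadratic forms: if `q` is a densely defined,
positive, closable sesquilinear form and `β` is a symmetric sesquilinear form with
`|β(φ,φ)| ≤ a·q(φ,φ) + b‖φ‖²` for some `0 ≤ a < 1`, then `γ = q + β` is bounded below by
`−b‖φ‖²` and closable (relative to the shifted form `γ + b‖·‖²`). -/
theorem klmn_for_quadratic_forms
    {H : Type*} [NormedAddCommGroup H] [InnerProductSpace ℂ H]
    (D : Submodule ℂ H) (hD : Dense (D : Set H))
    (q β : D → D → ℂ)
    -- `q` is sesquilinear
    (hq_addl : ∀ φ ψ χ : D, q (φ + ψ) χ = q φ χ + q ψ χ)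
    (hq_addr : ∀ φ ψ χ : D, q φ (ψ + χ) = q φ ψ + q φ χ)
    (hq_smull : ∀ (c : ℂ) (φ ψ : D), q (c • φ) ψ = starRingEnd ℂ c * q φ ψ)
    (hq_smulr : ∀ (c : ℂ) (φ ψ : D), q φ (c • ψ) = c * q φ ψ)
    -- `q(φ,φ) ≥ 0`
    (hq_pos : ∀ φ : D, q φ φ = (((q φ φ).re : ℝ) : ℂ) ∧ 0 ≤ (q φ φ).re)
    -- `q` is closable
    (hq_closable : ∀ φ : ℕ → D,
      Tendsto (fun n => ‖(φ n : H)‖) atTop (nhds 0) →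
      (∀ ε > (0 : ℝ), ∃ N₀ : ℕ, ∀ n ≥ N₀, ∀ m ≥ N₀,
        ‖q (φ n - φ m) (φ n - φ m)‖ < ε) →
      Tendsto (fun n => q (φ n) (φ n)) atTop (nhds 0))
    -- `β` is sesquilinear and symmetric
    (hβ_addl : ∀ φ ψ χ : D, β (φ + ψ) χ = β φ χ + β ψ χ)
    (hβ_addr : ∀ φ ψ χ : D, β φ (ψ + χ) = β φ ψ + β φ χ)
    (hβ_smull : ∀ (c : ℂ) (φ ψ : D), β (c • φ) ψ = starRingEnd ℂ c * β φ ψ)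
    (hβ_smulr : ∀ (c : ℂ) (φ ψ : D), β φ (c • ψ) = c * β φ ψ)
    (hβ_symm : ∀ φ ψ : D, β φ ψ = starRingEnd ℂ (β ψ φ))
    -- relative bound
    (a b : ℝ) (ha0 : 0 ≤ a) (ha1 : a < 1)
    (hβ_bound : ∀ φ : D, ‖β φ φ‖ ≤ a * (q φ φ).re + b * ‖(φ : H)‖ ^ 2) :
    -- conclusion: `γ = q + β` is bounded below by `−b‖·‖²` …
    (∀ φ : D, (q φ φ + β φ φ).im = 0 ∧ -(b * ‖(φ : H)‖ ^ 2) ≤ (q φ φ + β φ φ).re) ∧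
    -- … and closable in the corresponding sense
    (∀ φ : ℕ → D,
      Tendsto (fun n => ‖(φ n : H)‖) atTop (nhds 0) →
      (∀ ε > (0 : ℝ), ∃ N₀ : ℕ, ∀ n ≥ N₀, ∀ m ≥ N₀,
        ‖q (φ n - φ m) (φ n - φ m) + β (φ n - φ m) (φ n - φ m)
          + ((b * ‖((φ n - φ m : D) : H)‖ ^ 2 : ℝ) : ℂ)‖ < ε) →
      Tendsto (fun n => q (φ n) (φ n) + β (φ n) (φ n)) atTop (nhds 0)) := by
  have form_le : ∀ φ : D, (1 - a) * ‖q φ φ‖ ≤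
      (q φ φ + β φ φ + ((b * ‖(φ : H)‖ ^ 2 : ℝ) : ℂ)).re := by
    intro φ
    have hnorm : ‖q φ φ‖ = (q φ φ).re := by
      conv_lhs => rw [(hq_pos φ).1]
      exact Complex.norm_of_nonneg (hq_pos φ).2
    have hre := neg_le_of_abs_le ((Complex.abs_re_le_norm (β φ φ)).trans (hβ_bound φ))
    rw [hnorm, Complex.add_re, Complex.add_re, Complex.ofReal_re]
    linarith
  have ha : 0 < 1 - a := sub_pos.2 ha1
  refine ⟨fun φ => ⟨?_, ?_⟩, fun φ hφ hγ => ?_⟩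
  · have hq_im : (q φ φ).im = 0 := by rw [(hq_pos φ).1, Complex.ofReal_im]
    have hβ_im : (β φ φ).im = 0 := Complex.conj_eq_iff_im.1 (hβ_symm φ φ).symm
    rw [Complex.add_im, hq_im, hβ_im, add_zero]
  · have h := (mul_nonneg ha.le (norm_nonneg _)).trans (form_le φ)
    rw [Complex.add_re, Complex.ofReal_re] at h
    linarith
  · have hq : Tendsto (fun n => q (φ n) (φ n)) atTop (nhds 0) := by
      refine hq_closable φ hφ fun ε hε => ?_
      obtain ⟨N, hN⟩ := hγ ((1 - a) * ε) (mul_pos ha hε)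
      refine ⟨N, fun n hn m hm => lt_of_mul_lt_mul_left ?_ ha.le⟩
      exact ((form_le _).trans (Complex.re_le_norm _)).trans_lt (hN n hn m hm)
    have hbound : Tendsto (fun n => a * (q (φ n) (φ n)).re + b * ‖(φ n : H)‖ ^ 2)
        atTop (nhds 0) := by
      simpa using (((Complex.continuous_re.tendsto 0).comp hq).const_mul a).add
        ((hφ.pow 2).const_mul b)
    simpa using hq.add (squeeze_zero_norm (fun n => hβ_bound (φ n)) hbound)

end
end

section
/- Let d ∈ ℕ and let f : ℝ^d → ℂ be continuously differentiable with support contained in [−1/4, 1/4]^d. For n ∈ ℕ let c_n > 0 be determined by ∫_{−1}^{1} c_n (1 − t²)^n dt = 1, and define the polynomial kernel q_n(x) := ∏_{i=1}^d c_n (1 − x_i²)^n and Q_n f(x) := ∫_{ℝ^d} q_n(x − z) f(z) dz. Then each Q_n f is a polynomial function on ℝ^d, and Q_n f → f together with all first-order partial derivatives ∂_i (Q_n f) → ∂_i f, uniformly on [−1/2, 1/2]^d, as n → ∞. -/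
open MeasureTheory Finset

noncomputable section

abbrev E (d : ℕ) := EuclideanSpace ℝ (Fin d)

/-- The polynomial kernel `q_n(x) = ∏_i c_n (1 − x_i²)^n`. -/
def polyKer (d : ℕ) (c : ℕ → ℝ) (n : ℕ) (x : E d) : ℝ :=
  ∏ i : Fin d, c n * (1 - x i ^ 2) ^ n

/-- The smoothing operator `Q_n f(x) = ∫ q_n(x − z) f(z) dz`. -/
def polyConv (d : ℕ) (c : ℕ → ℝ) (f : E d → ℂ) (n : ℕ) (x : E d) : ℂ :=
  ∫ z : E d, (polyKer d c n (x - z) : ℂ) * f z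

/-- The Landau kernel `c (1 − t²)^n`, truncated to `[−1, 1]`. -/
def landau (c : ℕ → ℝ) (n : ℕ) : ℝ → ℝ :=
  (Set.Icc (-1 : ℝ) 1).indicator fun t => c n * (1 - t ^ 2) ^ n

lemma landau_nonneg {c : ℕ → ℝ} (hc : ∀ n, 0 < c n) (n : ℕ) (t : ℝ) : 0 ≤ landau c n t := by
  refine Set.indicator_nonneg (fun t ht => ?_) t
  have : 0 ≤ 1 - t ^ 2 := by nlinarith [ht.1, ht.2]
  have := (hc n).le
  positivity

lemma integrable_sq_mul_landau (c : ℕ → ℝ) (n k : ℕ) :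
    Integrable fun t => (t ^ 2) ^ k * landau c n t := by
  have h : (fun t => (t ^ 2) ^ k * landau c n t) =
      (Set.Icc (-1 : ℝ) 1).indicator fun t => (t ^ 2) ^ k * (c n * (1 - t ^ 2) ^ n) := by
    ext t
    simp only [landau, Set.indicator_mul_right]
  rw [h, integrable_indicator_iff measurableSet_Icc]
  exact Continuous.integrableOn_Icc (by fun_prop)

lemma integral_mul_landau (c : ℕ → ℝ) (n : ℕ) (g : ℝ → ℝ) :
    ∫ t, g t * landau c n t = ∫ t in (-1 : ℝ)..1, g t * (c n * (1 - t ^ 2) ^ n) := by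
  simp only [landau, ← Set.indicator_mul_right]
  rw [integral_indicator measurableSet_Icc, integral_Icc_eq_integral_Ioc,
    intervalIntegral.integral_of_le (by norm_num)]

lemma integral_landau {c : ℕ → ℝ} {n : ℕ}
    (hc : (∫ t in (-1 : ℝ)..1, c n * (1 - t ^ 2) ^ n) = 1) : ∫ t, landau c n t = 1 := by
  simpa [hc] using integral_mul_landau c n fun _ => 1

/-- The second moment of the normalized Landau kernel. -/
lemma integral_sq_mul_landau {c : ℕ → ℝ} {n : ℕ}
    (hc : (∫ t in (-1 : ℝ)..1, c n * (1 - t ^ 2) ^ n) = 1) :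
    ∫ t, t ^ 2 * landau c n t = 1 / (2 * n + 3) := by
  rw [integral_mul_landau]
  have hderiv : ∀ t : ℝ, HasDerivAt (fun t : ℝ => c n * (t * (1 - t ^ 2) ^ (n + 1)))
      (c n * (1 - t ^ 2) ^ n - (2 * n + 3) * (t ^ 2 * (c n * (1 - t ^ 2) ^ n))) t := by
    intro t
    have h := ((hasDerivAt_id t).mul
      ((((hasDerivAt_id t).pow 2).const_sub 1).pow (n + 1))).const_mul (c n)
    refine h.congr_deriv ?_
    simp
    ring
  have hint := intervalIntegral.integral_eq_sub_of_hasDerivAt (a := -1) (b := 1)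
    (fun t _ => hderiv t) (Continuous.intervalIntegrable (by fun_prop) _ _)
  rw [intervalIntegral.integral_sub (Continuous.intervalIntegrable (by fun_prop) _ _)
    (Continuous.intervalIntegrable (by fun_prop) _ _), hc,
    intervalIntegral.integral_const_mul] at hint
  norm_num at hint
  rw [eq_div_iff (by positivity)]
  linarith

/-- The product of the truncated Landau kernels in each coordinate. -/
def landauProd (d : ℕ) (c : ℕ → ℝ) (n : ℕ) (y : E d) : ℝ := ∏ i, landau c n (y i)

section Moments

variable {d : ℕ} {c : ℕ → ℝ} {n : ℕ}

lemma landauProd_nonneg (hc : ∀ n, 0 < c n) (y : E d) : 0 ≤ landauProd d c n y :=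
  Finset.prod_nonneg fun i _ => landau_nonneg hc n (y i)

lemma integral_euclidean (F : (Fin d → ℝ) → ℝ) : ∫ y : E d, F y.ofLp = ∫ y, F y :=
  (PiLp.volume_preserving_ofLp (Fin d)).integral_comp
    (MeasurableEquiv.toLp 2 (Fin d → ℝ)).symm.measurableEmbedding F

lemma integrable_euclidean {F : (Fin d → ℝ) → ℝ} (hF : Integrable F) :
    Integrable fun y : E d => F y.ofLp :=
  ((PiLp.volume_preserving_ofLp (Fin d)).integrable_comp_emb
    (MeasurableEquiv.toLp 2 (Fin d → ℝ)).symm.measurableEmbedding).2 hF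

lemma integrable_landauProd : Integrable (landauProd d c n) :=
  integrable_euclidean (Integrable.fintype_prod (f := fun _ => landau c n)
    fun _ => by simpa using integrable_sq_mul_landau c n 0)

lemma integral_landauProd (hc : (∫ t in (-1 : ℝ)..1, c n * (1 - t ^ 2) ^ n) = 1) :
    ∫ y, landauProd d c n y = 1 := by
  refine (integral_euclidean fun y => ∏ i, landau c n (y i)).trans ?_
  rw [integral_fintype_prod_volume_eq_prod (fun _ => landau c n)]
  simp [integral_landau hc]

lemma sq_mul_landauProd (i : Fin d) (y : E d) :
    y i ^ 2 * landauProd d c n y =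
      ∏ j, (y j ^ 2) ^ (if j = i then 1 else 0) * landau c n (y j) := by
  rw [Finset.prod_mul_distrib, landauProd]
  simp [pow_ite]

lemma integrable_sq_mul_landauProd (i : Fin d) :
    Integrable fun y => y i ^ 2 * landauProd d c n y := by
  simp only [sq_mul_landauProd]
  exact integrable_euclidean (Integrable.fintype_prod
    (f := fun j t => (t ^ 2) ^ (if j = i then 1 else 0) * landau c n t)
    fun _ => integrable_sq_mul_landau c n _)

lemma integral_sq_mul_landauProd (hc : (∫ t in (-1 : ℝ)..1, c n * (1 - t ^ 2) ^ n) = 1)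
    (i : Fin d) : ∫ y, y i ^ 2 * landauProd d c n y = 1 / (2 * n + 3) := by
  simp only [sq_mul_landauProd]
  refine (integral_euclidean fun y =>
    ∏ j, (y j ^ 2) ^ (if j = i then 1 else 0) * landau c n (y j)).trans ?_
  rw [integral_fintype_prod_volume_eq_prod
    (fun j t => (t ^ 2) ^ (if j = i then 1 else 0) * landau c n t)]
  rw [Finset.prod_eq_single i]
  · simpa using integral_sq_mul_landau hc
  · intro j _ hj
    simpa [hj] using integral_landau hc
  · simp

lemma integrable_normSq_mul_landauProd :
    Integrable fun y => ‖y‖ ^ 2 * landauProd d c n y := by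
  simp only [EuclideanSpace.real_norm_sq_eq, Finset.sum_mul]
  exact integrable_finsetSum _ fun i _ => integrable_sq_mul_landauProd i

lemma integral_normSq_mul_landauProd
    (hc : (∫ t in (-1 : ℝ)..1, c n * (1 - t ^ 2) ^ n) = 1) :
    ∫ y, ‖y‖ ^ 2 * landauProd d c n y = d / (2 * n + 3) := by
  simp only [EuclideanSpace.real_norm_sq_eq, Finset.sum_mul]
  rw [integral_finsetSum _ fun i _ => integrable_sq_mul_landauProd i]
  simp [integral_sq_mul_landauProd hc, div_eq_mul_inv]

lemma polyKer_eq_landauProd {y : E d} (hy : ∀ i, |y i| ≤ 1) :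
    polyKer d c n y = landauProd d c n y :=
  Finset.prod_congr rfl fun i _ => by rw [landau, Set.indicator_of_mem (Set.mem_Icc.2 (abs_le.1 (hy i)))]

end Moments

lemma continuous_polyKer (d : ℕ) (c : ℕ → ℝ) (n : ℕ) : Continuous (polyKer d c n) := by
  unfold polyKer
  fun_prop

lemma isCompact_box (d : ℕ) (r : ℝ) : IsCompact {x : E d | ∀ i, |x i| ≤ r} := by
  have h := (isCompact_univ_pi fun _ : Fin d => isCompact_Icc (a := -r) (b := r)).image
    (PiLp.continuous_toLp 2 fun _ : Fin d => ℝ)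
  convert h using 1
  ext x
  simp only [Set.mem_ofPred_eq, Set.mem_image, Set.mem_univ_pi, Set.mem_Icc, abs_le]
  exact ⟨fun hx => ⟨x.ofLp, hx, rfl⟩, by rintro ⟨y, hy, rfl⟩; exact hy⟩

/-- The modulus of continuity of a bounded uniformly continuous function is dominated by
`ε + C ‖y‖²`. -/
lemma exists_norm_sub_le_add_sq {V F : Type*} [NormedAddCommGroup V] [NormedAddCommGroup F]
    {g : V → F} (hg : UniformContinuous g) {M : ℝ} (hM : ∀ x, ‖g x‖ ≤ M) {ε : ℝ} (hε : 0 < ε) :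
    ∃ C : ℝ, ∀ x y, ‖g (x - y) - g x‖ ≤ ε + C * ‖y‖ ^ 2 := by
  obtain ⟨δ, hδ, h⟩ := Metric.uniformContinuous_iff.1 hg ε hε
  have hM0 : 0 ≤ M := (norm_nonneg _).trans (hM 0)
  refine ⟨2 * M / δ ^ 2, fun x y => ?_⟩
  rcases lt_or_ge ‖y‖ δ with hy | hy
  · have h1 : dist (x - y) x < δ := by simpa [dist_eq_norm] using hy
    have h2 := h h1
    rw [dist_eq_norm] at h2
    have : 0 ≤ 2 * M / δ ^ 2 * ‖y‖ ^ 2 := by positivity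
    linarith
  · have h1 : ‖g (x - y) - g x‖ ≤ 2 * M := by
      linarith [norm_sub_le (g (x - y)) (g x), hM x, hM (x - y)]
    have h2 : 2 * M ≤ 2 * M / δ ^ 2 * ‖y‖ ^ 2 := by
      rw [div_mul_eq_mul_div, le_div_iff₀ (by positivity)]
      gcongr
    linarith

lemma tendstoUniformlyOn_integral_polyKer_smul {d : ℕ} {c : ℕ → ℝ} (hc_pos : ∀ n, 0 < c n)
    (hc : ∀ n : ℕ, (∫ t in (-1 : ℝ)..1, c n * (1 - t ^ 2) ^ n) = 1)
    {g : E d → ℂ} (hg : Continuous g)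
    (hsupp : tsupport g ⊆ { x : E d | ∀ i : Fin d, |x i| ≤ 1 / 4 }) :
    TendstoUniformlyOn (fun n x => ∫ y, polyKer d c n y • g (x - y)) g Filter.atTop
      { x : E d | ∀ i : Fin d, |x i| ≤ 1 / 2 } := by
  have hcs : HasCompactSupport g :=
    (isCompact_box d (1 / 4)).of_isClosed_subset (isClosed_tsupport g) hsupp
  obtain ⟨M, hM⟩ := hcs.exists_bound_of_continuous hg
  rw [Metric.tendstoUniformlyOn_iff]
  intro ε hε
  obtain ⟨C, hC⟩ := exists_norm_sub_le_add_sq (hcs.uniformContinuous_of_continuous hg) hM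
    (half_pos hε)
  have hlim : Filter.Tendsto (fun n : ℕ => ε / 2 + C * (d / (2 * n + 3))) Filter.atTop
      (nhds (ε / 2 + C * 0)) := by
    refine ((Filter.Tendsto.const_div_atTop ?_ _).const_mul C).const_add _
    exact Filter.tendsto_atTop_add_const_right _ _
      (tendsto_natCast_atTop_atTop.const_mul_atTop two_pos)
  filter_upwards [hlim.eventually_lt_const (show ε / 2 + C * 0 < ε by linarith)] with n hn x hx
  have hker : ∀ y, polyKer d c n y • g (x - y) = landauProd d c n y • g (x - y) := by
    intro y
    by_cases h0 : g (x - y) = 0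
    · simp [h0]
    · rw [polyKer_eq_landauProd]
      intro i
      have h1 := abs_le.1 (hsupp (subset_tsupport _ h0) i)
      have h2 := abs_le.1 (hx i)
      rw [PiLp.sub_apply] at h1
      exact abs_le.2 ⟨by linarith [h1.2, h2.1], by linarith [h1.1, h2.2]⟩
  simp only [hker]
  have hint : Integrable fun y => landauProd d c n y • g (x - y) :=
    integrable_landauProd.smul_bdd M (by fun_prop) (.of_forall fun y => hM _)
  have hdiff : (∫ y, landauProd d c n y • g (x - y)) - g x =
      ∫ y, landauProd d c n y • (g (x - y) - g x) := by
    simp only [smul_sub]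
    rw [integral_sub hint (integrable_landauProd.smul_const _), integral_smul_const,
      integral_landauProd (hc n), one_smul]
  rw [dist_comm, dist_eq_norm, hdiff]
  refine lt_of_le_of_lt ?_ hn
  have hbound : Integrable fun y =>
      ε / 2 * landauProd d c n y + C * (‖y‖ ^ 2 * landauProd d c n y) :=
    (integrable_landauProd.const_mul _).add (integrable_normSq_mul_landauProd.const_mul _)
  refine (norm_integral_le_of_norm_le hbound (.of_forall fun y => ?_)).trans_eq ?_
  · rw [norm_smul, Real.norm_of_nonneg (landauProd_nonneg hc_pos y)]
    nlinarith [mul_le_mul_of_nonneg_left (hC x y) (landauProd_nonneg (n := n) hc_pos y)]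
  · rw [integral_add (integrable_landauProd.const_mul _)
      (integrable_normSq_mul_landauProd.const_mul _), integral_const_mul, integral_const_mul,
      integral_landauProd (hc n), integral_normSq_mul_landauProd (hc n), mul_one]

lemma polyConv_eq_integral_smul {d : ℕ} (c : ℕ → ℝ) (f : E d → ℂ) (n : ℕ) (x : E d) :
    polyConv d c f n x = ∫ y, polyKer d c n y • f (x - y) := by
  rw [polyConv, ← integral_sub_left_eq_self _ volume x]
  simp [Complex.real_smul]

lemma fderiv_polyConv_apply {d : ℕ} (c : ℕ → ℝ) {f : E d → ℂ} (hf : ContDiff ℝ 1 f)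
    (hcs : HasCompactSupport f) (n : ℕ) (x v : E d) :
    fderiv ℝ (polyConv d c f n) x v = ∫ y, polyKer d c n y • fderiv ℝ f (x - y) v := by
  have hloc : LocallyIntegrable (polyKer d c n) := (continuous_polyKer d c n).locallyIntegrable
  have hconv : polyConv d c f n =
      convolution (polyKer d c n) f (ContinuousLinearMap.lsmul ℝ ℝ) volume :=
    funext fun x => polyConv_eq_integral_smul c f n x
  rw [hconv, (hcs.hasFDerivAt_convolution_right _ hloc hf x).fderiv,
    convolution_precompR_apply _ hloc (hcs.fderiv ℝ) (hf.continuous_fderiv one_ne_zero)]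
  rfl

/-- Integrating out half of the variables of a polynomial against a continuous compactly supported
function gives a polynomial in the remaining variables. -/
lemma exists_eval_eq_integral {ι : Type*} [Fintype ι] {f : EuclideanSpace ℝ ι → ℂ}
    (hf : Continuous f) (hcs : HasCompactSupport f) (P : MvPolynomial (ι ⊕ ι) ℂ) :
    ∃ p : MvPolynomial ι ℂ, ∀ x : EuclideanSpace ℝ ι,
      ∫ z : EuclideanSpace ℝ ι,
        MvPolynomial.eval (Sum.elim (fun i => (x i : ℂ)) fun i => (z i : ℂ)) P * f z =
      MvPolynomial.eval (fun i => (x i : ℂ)) p := by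
  induction P using MvPolynomial.induction_on' with
  | monomial m a =>
    refine ⟨MvPolynomial.C (∫ z : EuclideanSpace ℝ ι, (∏ i, (z i : ℂ) ^ m (Sum.inr i)) * f z) *
      MvPolynomial.C a * ∏ i, MvPolynomial.X i ^ m (Sum.inl i), fun x => ?_⟩
    simp only [MvPolynomial.eval_monomial, map_mul, MvPolynomial.eval_C, map_prod, map_pow,
      MvPolynomial.eval_X]
    rw [mul_assoc, ← integral_mul_const]
    refine integral_congr_ae (.of_forall fun z => ?_)
    simp only [Finsupp.prod_fintype, pow_zero, implies_true, Fintype.prod_sum_type, Sum.elim_inl,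
      Sum.elim_inr]
    ring
  | add P Q hP hQ =>
    obtain ⟨p, hp⟩ := hP
    obtain ⟨q, hq⟩ := hQ
    refine ⟨p + q, fun x => ?_⟩
    have hint : ∀ R : MvPolynomial (ι ⊕ ι) ℂ, Integrable fun z : EuclideanSpace ℝ ι =>
        MvPolynomial.eval (Sum.elim (fun i => (x i : ℂ)) fun i => (z i : ℂ)) R * f z := by
      intro R
      refine Continuous.integrable_of_hasCompactSupport (Continuous.mul ?_ hf) hcs.mul_left
      refine (MvPolynomial.continuous_eval R).comp (continuous_pi ?_)
      rintro (i | i) <;> simp only [Sum.elim_inl, Sum.elim_inr] <;> fun_prop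
    simp only [map_add, add_mul]
    rw [integral_add (hint P) (hint Q), hp, hq]

lemma exists_eval_eq_polyConv {d : ℕ} (c : ℕ → ℝ) {f : E d → ℂ} (hf : Continuous f)
    (hcs : HasCompactSupport f) (n : ℕ) :
    ∃ p : MvPolynomial (Fin d) ℂ,
      ∀ x : E d, polyConv d c f n x = MvPolynomial.eval (fun i => ((x i : ℝ) : ℂ)) p := by
  obtain ⟨p, hp⟩ := exists_eval_eq_integral hf hcs
    (∏ i : Fin d, MvPolynomial.C (c n : ℂ) *
      (1 - (MvPolynomial.X (Sum.inl i) - MvPolynomial.X (Sum.inr i)) ^ 2) ^ n)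
  refine ⟨p, fun x => ?_⟩
  rw [← hp, polyConv]
  simp [polyKer]

/-- for `f ∈ C¹` supported in `[−1/4,1/4]^d`, the convolutions `Q_n f`
with the kernels `q_n(x) = ∏_i c_n(1−x_i²)^n` are polynomial functions, and
`Q_n f → f` and `∂_i(Q_n f) → ∂_i f` uniformly on `[−1/2,1/2]^d` as `n → ∞`. -/
theorem polynomial_approximation
    (d : ℕ) (f : E d → ℂ) (hf : ContDiff ℝ 1 f)
    (hsupp : tsupport f ⊆ { x : E d | ∀ i : Fin d, |x i| ≤ 1 / 4 })
    (c : ℕ → ℝ) (hc_pos : ∀ n, 0 < c n)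
    (hc : ∀ n : ℕ, (∫ t in (-1 : ℝ)..1, c n * (1 - t ^ 2) ^ n) = 1) :
    (∀ n : ℕ, ∃ p : MvPolynomial (Fin d) ℂ,
      ∀ x : E d, polyConv d c f n x = MvPolynomial.eval (fun i => ((x i : ℝ) : ℂ)) p) ∧
    TendstoUniformlyOn (fun n x => polyConv d c f n x) f Filter.atTop
      { x : E d | ∀ i : Fin d, |x i| ≤ 1 / 2 } ∧
    (∀ i : Fin d,
      TendstoUniformlyOn
        (fun n x => fderiv ℝ (polyConv d c f n) x (EuclideanSpace.single i 1))
        (fun x => fderiv ℝ f x (EuclideanSpace.single i 1)) Filter.atTop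
        { x : E d | ∀ i : Fin d, |x i| ≤ 1 / 2 }) := by
  have hcs : HasCompactSupport f :=
    (isCompact_box d (1 / 4)).of_isClosed_subset (isClosed_tsupport f) hsupp
  refine ⟨exists_eval_eq_polyConv c hf.continuous hcs, ?_, fun i => ?_⟩
  · simp only [polyConv_eq_integral_smul]
    exact tendstoUniformlyOn_integral_polyKer_smul hc_pos hc hf.continuous hsupp
  · simp only [fderiv_polyConv_apply c hf hcs]
    exact tendstoUniformlyOn_integral_polyKer_smul hc_pos hc
      ((hf.continuous_fderiv one_ne_zero).clm_apply continuous_const)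
      ((tsupport_fderiv_apply_subset ℝ _).trans hsupp)

end
end
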